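/- arXiv:0712.1237 — 3 statements merged into one kernel-verified Lean document; each statement's English description precedes it below -/
import Mathlib

section
/- For every u ∈ U_n there exists exactly one v ∈ U_n such that v − 1 ∈ 𝒮_n(q) and u − 1 lies in the two-sided orbit U_n(v−1)U_n = {a(v−1)b : a, b ∈ U_n}. In other words, the matrices v ∈ U_n such that v − 1 has at most one nonzero entry in every row and every column form a complete set of representatives for the superclasses of U_n. -/
open Matrix BigOperators
open scoped Classical

/-- `n × n` matrices over `F`. -/
abbrev Mat (n : ℕ) (F : Type*) := Matrix (Fin n) (Fin n) F

section Defs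

variable {n : ℕ} {F : Type*} [Field F] [Fintype F]

/-- The pattern group `U_P` attached to a relation `P` on `{0,…,n-1}`:
unipotent upper-triangular matrices supported (off the diagonal) on positions `(i,j)` with `P i j`. -/
def patGroup (P : Fin n → Fin n → Prop) : Set (Mat n F) :=
  {u | (∀ i, u i i = 1) ∧ ∀ i j, i ≠ j → ¬ P i j → u i j = 0}

/-- Truncation of a matrix to the positions allowed by `P` (used to identify a functional on
`𝔫_P` with the matrix of its coefficients on allowable positions). -/
noncomputable def truncP (P : Fin n → Fin n → Prop) (A : Mat n F) : Mat n F :=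
  Matrix.of fun i j => if P i j then A i j else 0

/-- The left orbit `U_P λ` of the functional (identified with a matrix) `lam`:
`(aλ)(x) = λ(a⁻¹ x)`, whose coefficient matrix is the truncation of `(a⁻¹)ᵀ * λ`. -/
noncomputable def dualLeftOrbit (P : Fin n → Fin n → Prop) (lam : Mat n F) : Set (Mat n F) :=
  {mu | ∃ a ∈ (patGroup P : Set (Mat n F)), mu = truncP P ((a⁻¹)ᵀ * lam)}

/-- The two-sided orbit `U_P λ U_P` of the functional `lam`: `(aλb)(x) = λ(a⁻¹ x b⁻¹)`,
whose coefficient matrix is the truncation of `(a⁻¹)ᵀ * λ * (b⁻¹)ᵀ`. -/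
noncomputable def dualOrbit (P : Fin n → Fin n → Prop) (lam : Mat n F) : Set (Mat n F) :=
  {mu | ∃ a ∈ (patGroup P : Set (Mat n F)), ∃ b ∈ (patGroup P : Set (Mat n F)),
    mu = truncP P ((a⁻¹)ᵀ * lam * (b⁻¹)ᵀ)}

/-- The two-sided superclass orbit `{a (v-1) b : a, b ∈ U_P}` attached to `v ∈ U_P`. -/
def classOrbit (P : Fin n → Fin n → Prop) (v : Mat n F) : Set (Mat n F) :=
  {x | ∃ a ∈ (patGroup P : Set (Mat n F)), ∃ b ∈ (patGroup P : Set (Mat n F)),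
    x = a * (v - 1) * b}

/-- The pairing `λ(x) = Σ_{i,j} λ_{ij} x_{ij}` of a functional-matrix with a matrix. -/
def pairM (A B : Mat n F) : F := ∑ i, ∑ j, A i j * B i j

/-- The supercharacter `χ^λ` of the pattern group `U_P` attached to the functional `lam`:
`χ^λ(u) = (|U_Pλ|/|U_PλU_P|) Σ_{μ ∈ U_PλU_P} θ(−μ(u−1))`. -/
noncomputable def superChar (P : Fin n → Fin n → Prop) (θ : AddChar F ℂ)
    (lam u : Mat n F) : ℂ :=
  ((dualLeftOrbit P lam).ncard : ℂ) / ((dualOrbit P lam).ncard : ℂ) *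
    ∑ᶠ mu ∈ dualOrbit P lam, θ (- pairM mu (u - 1))

/-- The full order `i < j`, whose pattern group is `U_n`. -/
def Plt (n : ℕ) : Fin n → Fin n → Prop := fun i j => i < j

/-- The poset `𝒫_(m)` (in 0-based indexing): `i < j`, except that row `0` (row `1` in 1-based
indexing) is only comparable to columns `j` with 1-based value `j+1 > m`.  Its pattern group is
the interpolating group `U_(m)`. -/
def Pm (n m : ℕ) : Fin n → Fin n → Prop := fun i j => i < j ∧ (i.val = 0 → m < j.val + 1)

/-- `𝒮_n(q)`: strictly upper-triangular matrices with at most one nonzero entry in each row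
and each column. -/
def Sset (n : ℕ) (F : Type*) [Field F] : Set (Mat n F) :=
  {lam | (∀ i j : Fin n, ¬ i < j → lam i j = 0) ∧
    (∀ (i j j' : Fin n), lam i j ≠ 0 → lam i j' ≠ 0 → j = j') ∧
    (∀ (i i' j : Fin n), lam i j ≠ 0 → lam i' j ≠ 0 → i = i')}

/-- Adjacency of two nonzero positions of `A` (they share a row or a column): the edges of
the graph `G_A`. -/
def adjRel (A : Mat n F) (p q : Fin n × Fin n) : Prop :=
  p ≠ q ∧ A p.1 p.2 ≠ 0 ∧ A q.1 q.2 ≠ 0 ∧ (p.1 = q.1 ∨ p.2 = q.2)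

/-- The connected component of the position `p` in the graph `G_A`. -/
def compOf (A : Mat n F) (p : Fin n × Fin n) : Set (Fin n × Fin n) :=
  {q | Relation.ReflTransGen (adjRel A) p q}

/-- The set of connected components of the graph `G_A`. -/
def comps (A : Mat n F) : Set (Set (Fin n × Fin n)) :=
  {S | ∃ p : Fin n × Fin n, A p.1 p.2 ≠ 0 ∧ S = compOf A p}

/-- The matrix agreeing with `A` on the positions of `S` and vanishing elsewhere. -/
noncomputable def restrictTo (S : Set (Fin n × Fin n)) (A : Mat n F) : Mat n F :=
  Matrix.of fun i j => if (i, j) ∈ S then A i j else 0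

/-- At most one connected component of `G_A` has more than one vertex. -/
def AtMostOneBig (A : Mat n F) : Prop :=
  ∀ p q : Fin n × Fin n, A p.1 p.2 ≠ 0 → A q.1 q.2 ≠ 0 →
    1 < (compOf A p).ncard → 1 < (compOf A q).ncard → compOf A p = compOf A q

end Defs

section Helpers

variable {n : ℕ} {F : Type*} [Field F]

theorem mem_patGroup_Plt_iff {a : Mat n F} :
    a ∈ patGroup (Plt n) ↔ (∀ i, a i i = 1) ∧ ∀ i j, j < i → a i j = 0 := by
  refine and_congr_right fun _ => forall₂_congr fun i j => ?_
  simp only [Plt, not_lt]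
  exact ⟨fun h hji => h hji.ne' hji.le, fun h hij hji => h (lt_of_le_of_ne hji hij.symm)⟩

theorem mul_apply_self_of_upperTriangular {R : Type*} [NonUnitalNonAssocSemiring R] {a b : Mat n R}
    (ha : ∀ i j, j < i → a i j = 0) (hb : ∀ i j, j < i → b i j = 0) (i : Fin n) :
    (a * b) i i = a i i * b i i := by
  rw [Matrix.mul_apply]
  refine Finset.sum_eq_single i (fun k _ hk => ?_) (by simp)
  rcases lt_or_gt_of_ne hk with h | h
  · rw [ha _ _ h, zero_mul]
  · rw [hb _ _ h, mul_zero]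

theorem mul_mem_patGroup_Plt {a b : Mat n F} (ha : a ∈ patGroup (Plt n))
    (hb : b ∈ patGroup (Plt n)) : a * b ∈ patGroup (Plt n) := by
  rw [mem_patGroup_Plt_iff] at *
  refine ⟨fun i => by rw [mul_apply_self_of_upperTriangular ha.2 hb.2, ha.1, hb.1, one_mul], ?_⟩
  exact BlockTriangular.mul (b := id) (fun i j h => ha.2 i j h) (fun i j h => hb.2 i j h)

theorem isUnit_det_of_mem_patGroup_Plt {a : Mat n F} (ha : a ∈ patGroup (Plt n)) :
    IsUnit a.det := by
  rw [mem_patGroup_Plt_iff] at ha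
  rw [det_of_isUpperTriangular (fun i j h => ha.2 i j h)]
  simp [ha.1]

theorem inv_mem_patGroup_Plt {a : Mat n F} (ha : a ∈ patGroup (Plt n)) :
    a⁻¹ ∈ patGroup (Plt n) := by
  have hdet := isUnit_det_of_mem_patGroup_Plt ha
  rw [mem_patGroup_Plt_iff] at *
  have := invertibleOfIsUnitDet a hdet
  have hinv : ∀ i j, j < i → a⁻¹ i j = 0 :=
    blockTriangular_inv_of_blockTriangular (b := id) (fun i j h => ha.2 i j h)
  refine ⟨fun i => ?_, hinv⟩
  have h := mul_apply_self_of_upperTriangular ha.2 hinv i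
  rw [mul_nonsing_inv a hdet, one_apply_eq, ha.1, one_mul] at h
  exact h.symm

/-- Multiplying a strictly upper triangular matrix by upper triangular ones on both sides keeps
it strictly upper triangular. -/
theorem mul_mul_apply_eq_zero {R : Type*} [NonUnitalNonAssocSemiring R] {a b N : Mat n R}
    (ha : ∀ i j, j < i → a i j = 0) (hb : ∀ i j, j < i → b i j = 0)
    (hN : ∀ i j, ¬ i < j → N i j = 0) {i j : Fin n} (hij : ¬ i < j) : (a * N * b) i j = 0 := by
  rw [Matrix.mul_apply]
  refine Finset.sum_eq_zero fun l _ => ?_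
  rcases lt_or_ge j l with h | h
  · rw [hb _ _ h, mul_zero]
  rw [Matrix.mul_apply, Finset.sum_eq_zero, zero_mul]
  intro k _
  rcases lt_or_ge k i with h' | h'
  · rw [ha _ _ h', zero_mul]
  · rw [hN _ _ (by grind), mul_zero]

/-- The columns of `Y` with index below `k` are reduced: each nonzero entry in one of them is the
only nonzero entry of its row and of its column. -/
def ReducedBelow (k : ℕ) (Y : Mat n F) : Prop :=
  ∀ i j, j.val < k → Y i j ≠ 0 →
    (∀ i', Y i' j ≠ 0 → i' = i) ∧ ∀ j', Y i j' ≠ 0 → j' = j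

/-- Clearing the column `k` and the row `i` with the entry `(i, k)`, the lowest nonzero entry of
its column. -/
theorem exists_clear {Y : Mat n F} {i k : Fin n} (hik : Y i k ≠ 0)
    (hmax : ∀ r, i < r → Y r k = 0) (hleft : ∀ j, j < k → Y i j = 0) :
    ∃ p ∈ (patGroup (Plt n) : Set (Mat n F)), ∃ q ∈ (patGroup (Plt n) : Set (Mat n F)),
      p * Y * q = Matrix.of fun r j =>
        if r = i then (if j = k then Y i k else 0) else Y r j - Y r k / Y i k * Y i j := by
  let c : Fin n → F := fun r => if r = i then 0 else Y r k / Y i k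
  let d : Fin n → F := fun j => if j = k then 0 else Y i j / Y i k
  refine ⟨1 - vecMulVec c (Pi.single i 1), ?_, 1 - vecMulVec (Pi.single k 1) d, ?_, ?_⟩
  · rw [mem_patGroup_Plt_iff]
    refine ⟨fun r => ?_, fun r j hjr => ?_⟩
    · by_cases hr : r = i <;> simp [vecMulVec_apply, c, hr]
    · by_cases hj : j = i
      · subst hj
        simp [vecMulVec_apply, c, hmax r hjr, hjr.ne']
      · simp [vecMulVec_apply, hj, hjr.ne']
  · rw [mem_patGroup_Plt_iff]
    refine ⟨fun r => ?_, fun r j hjr => ?_⟩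
    · by_cases hr : r = k <;> simp [vecMulVec_apply, d, hr]
    · by_cases hr : r = k
      · subst hr
        simp [vecMulVec_apply, d, hleft j hjr, hjr.ne']
      · simp [vecMulVec_apply, hr, hjr.ne']
  · ext r j
    have hrow : ∀ r j, ((1 - vecMulVec c (Pi.single i 1)) * Y) r j = Y r j - c r * Y i j := by
      intro r j
      rw [Matrix.sub_mul, Matrix.one_mul, vecMulVec_mul, Matrix.sub_apply, vecMulVec_apply,
        single_one_vecMul]
      rfl
    rw [Matrix.mul_sub, Matrix.mul_one, mul_vecMulVec, Matrix.sub_apply, vecMulVec_apply,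
      mulVec_single_one, hrow, col_apply, hrow, of_apply]
    by_cases hr : r = i
    · subst hr
      by_cases hj : j = k
      · simp [c, d, hj]
      · simp [c, d, hj, mul_div_cancel₀, hik]
    · simp [c, hr, hik]

theorem exists_reducedBelow (X : Mat n F) (k : ℕ) (hk : k ≤ n) :
    ∃ a ∈ (patGroup (Plt n) : Set (Mat n F)), ∃ b ∈ (patGroup (Plt n) : Set (Mat n F)),
      ReducedBelow k (a * X * b) := by
  induction k with
  | zero =>
    have h1 : (1 : Mat n F) ∈ patGroup (Plt n) :=
      mem_patGroup_Plt_iff.2 ⟨fun i => one_apply_eq i, fun i j h => one_apply_ne h.ne'⟩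
    exact ⟨1, h1, 1, h1, fun i j h => absurd h (Nat.not_lt_zero _)⟩
  | succ k ih =>
    obtain ⟨a, ha, b, hb, hY⟩ := ih (by omega)
    generalize hYdef : a * X * b = Y at hY
    let κ : Fin n := ⟨k, hk⟩
    by_cases hz : ∀ r, Y r κ = 0
    · refine ⟨a, ha, b, hb, fun i j hj hij => ?_⟩
      rw [hYdef] at hij ⊢
      refine hY i j (lt_of_le_of_ne (Nat.lt_succ_iff.1 hj) fun h => hij ?_) hij
      rw [show j = κ from Fin.ext h, hz]
    · push Not at hz
      obtain ⟨i, hi, hmax⟩ := Set.exists_max_image {r | Y r κ ≠ 0} id (Set.toFinite _) hz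
      have hleft : ∀ j, j < κ → Y i j = 0 := fun j hj => by
        by_contra h
        exact hj.ne' ((hY i j hj h).2 κ hi)
      obtain ⟨p, hp, q, hq, hpq⟩ := exists_clear hi
        (fun r hr => by by_contra h; exact hr.not_ge (hmax r h)) hleft
      refine ⟨p * a, mul_mem_patGroup_Plt hp ha, b * q, mul_mem_patGroup_Plt hb hq, ?_⟩
      rw [show p * a * X * (b * q) = p * Y * q by simp only [← hYdef, Matrix.mul_assoc], hpq]
      have hκ : κ.val = k := rfl
      intro r j hj hrj
      simp only [of_apply] at hrj ⊢
      rcases eq_or_ne j κ with rfl | hjκ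
      · grind
      · have hj' : j < κ := by rw [Fin.lt_def]; have := Fin.val_ne_of_ne hjκ; omega
        have h0 := hleft j hj'
        have hri : r ≠ i := by rintro rfl; simp [hjκ] at hrj
        simp only [hri, if_false, h0, mul_zero, sub_zero] at hrj
        obtain ⟨h1, h2⟩ := hY r j hj' hrj
        have h3 : Y r κ = 0 := by by_contra h; exact hjκ (h2 κ h).symm
        refine ⟨fun i' hi' => h1 i' ?_, fun j' hj' => h2 j' ?_⟩
        · by_cases h : i' = i
          · simp [h, hjκ] at hi'
          · simpa [h, h0] using hi'
        · simpa [hri, h3] using hj'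

/-- Two matrices of `𝒮_n(q)` in the same two-sided orbit are equal. -/
theorem eq_of_mul_eq_mul {A B a b : Mat n F} (hA : A ∈ Sset n F) (hB : B ∈ Sset n F)
    (ha : a ∈ patGroup (Plt n)) (hb : b ∈ patGroup (Plt n)) (h : a * A = B * b) : A = B := by
  rw [mem_patGroup_Plt_iff] at ha hb
  obtain ⟨-, hArow, hAcol⟩ := hA
  obtain ⟨-, hBrow, hBcol⟩ := hB
  have hleft : ∀ i k j, A k j ≠ 0 → (a * A) i j = a i k * A k j := fun i k j hk => by
    rw [Matrix.mul_apply]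
    refine Finset.sum_eq_single k (fun l _ hl => ?_) (by simp)
    by_contra h0
    exact hl (hAcol l k j (right_ne_zero_of_mul h0) hk)
  have hright : ∀ i k j, B i k ≠ 0 → (B * b) i j = B i k * b k j := fun i k j hk => by
    rw [Matrix.mul_apply]
    refine Finset.sum_eq_single k (fun l _ hl => ?_) (by simp)
    by_contra h0
    exact hl (hBrow i l k (left_ne_zero_of_mul h0) hk)
  have hAB : ∀ k j, A k j ≠ 0 → ∃ l, l ≤ j ∧ B k l ≠ 0 := fun k j hkj => by
    have h1 : (B * b) k j ≠ 0 := by rwa [← h, hleft k k j hkj, ha.1, one_mul]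
    rw [Matrix.mul_apply] at h1
    obtain ⟨l, -, hl⟩ := Finset.exists_ne_zero_of_sum_ne_zero h1
    refine ⟨l, not_lt.1 fun hlt => hl ?_, left_ne_zero_of_mul hl⟩
    rw [hb.2 _ _ hlt, mul_zero]
  have hBA : ∀ k j, B k j ≠ 0 → ∃ l, A l j ≠ 0 := fun k j hkj => by
    have h1 : (a * A) k j ≠ 0 := by rwa [h, hright k j j hkj, hb.1, mul_one]
    rw [Matrix.mul_apply] at h1
    obtain ⟨l, -, hl⟩ := Finset.exists_ne_zero_of_sum_ne_zero h1
    exact ⟨l, right_ne_zero_of_mul hl⟩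
  have key : ∀ j k, A k j ≠ 0 → A k j = B k j := by
    intro j
    induction j using WellFoundedLT.induction with
    | ind j ih =>
      intro k hkj
      obtain ⟨l, hlj, hkl⟩ := hAB k j hkj
      rcases hlj.eq_or_lt with rfl | hlt
      · rw [← one_mul (A k l), ← ha.1 k, ← hleft k k l hkj, h, hright k l l hkl, hb.1, mul_one]
      · obtain ⟨m, hml⟩ := hBA k l hkl
        have hmk : m = k := hBcol m k l (ih l hlt m hml ▸ hml) hkl
        subst hmk
        exact absurd (hArow m l j hml hkj) hlt.ne
  ext k j
  by_cases hkj : A k j = 0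
  · by_contra hne
    have hB0 : B k j ≠ 0 := fun h0 => hne (hkj.trans h0.symm)
    obtain ⟨m, hm⟩ := hBA k j hB0
    have hmk : m = k := hBcol m k j (key j m hm ▸ hm) hB0
    exact hm (hmk ▸ hkj)
  · exact key j k hkj

end Helpers

/-- The matrices `v ∈ U_n` with `v − 1 ∈ 𝒮_n(q)` form a complete set of
representatives for the superclasses of `U_n`: for every `u ∈ U_n` there is exactly one such `v`
with `u − 1 ∈ U_n (v−1) U_n`. -/
theorem stmt0 {n : ℕ} (hn : 1 ≤ n) {F : Type*} [Field F] [Fintype F]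
    (u : Mat n F) (hu : u ∈ patGroup (Plt n)) :
    ∃! v : Mat n F, v ∈ patGroup (Plt n) ∧ (v - 1) ∈ Sset n F ∧
      (u - 1) ∈ classOrbit (Plt n) v := by
  obtain ⟨a, ha, b, hb, hred⟩ := exists_reducedBelow (u - 1) n le_rfl
  have hN : ∀ i j, ¬ i < j → (u - 1) i j = 0 := fun i j hij => by
    rw [mem_patGroup_Plt_iff] at hu
    rcases eq_or_ne i j with rfl | hne
    · simp [hu.1]
    · simp [hne, hu.2 i j (lt_of_le_of_ne (not_lt.1 hij) hne.symm)]
  have hS : ∀ i j, ¬ i < j → (a * (u - 1) * b) i j = 0 := fun i j hij =>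
    mul_mul_apply_eq_zero (mem_patGroup_Plt_iff.1 ha).2 (mem_patGroup_Plt_iff.1 hb).2 hN hij
  have hda := isUnit_det_of_mem_patGroup_Plt ha
  have hdb := isUnit_det_of_mem_patGroup_Plt hb
  refine existsUnique_of_exists_of_unique ⟨1 + a * (u - 1) * b, ?_, ?_, ?_⟩ ?_
  · rw [mem_patGroup_Plt_iff]
    refine ⟨fun i => ?_, fun i j hji => ?_⟩
    · rw [Matrix.add_apply, hS i i (lt_irrefl i), one_apply_eq, add_zero]
    · rw [Matrix.add_apply, hS i j hji.not_gt, one_apply_ne hji.ne', add_zero]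
  · rw [add_sub_cancel_left]
    exact ⟨hS, fun i j j' h h' => (hred i j' j'.isLt h').2 j h,
      fun i i' j h h' => (hred i' j j.isLt h').1 i h⟩
  · refine ⟨a⁻¹, inv_mem_patGroup_Plt ha, b⁻¹, inv_mem_patGroup_Plt hb, ?_⟩
    rw [add_sub_cancel_left, Matrix.mul_assoc a, nonsing_inv_mul_cancel_left _ _ hda,
      mul_nonsing_inv_cancel_right _ _ hdb]
  · rintro v w ⟨-, hv, c, hc, d, hd, hcd⟩ ⟨-, hw, e, he, f, hf, hef⟩
    have hdd := isUnit_det_of_mem_patGroup_Plt hd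
    have hde := isUnit_det_of_mem_patGroup_Plt he
    refine sub_left_injective (b := (1 : Mat n F)) (eq_of_mul_eq_mul hv hw
      (mul_mem_patGroup_Plt (inv_mem_patGroup_Plt he) hc)
      (mul_mem_patGroup_Plt hf (inv_mem_patGroup_Plt hd)) ?_)
    rw [Matrix.mul_assoc, ← mul_nonsing_inv_cancel_right d (c * (v - 1)) hdd, ← hcd, hef,
      Matrix.mul_assoc e, Matrix.mul_assoc e, nonsing_inv_mul_cancel_left _ _ hde,
      Matrix.mul_assoc]
end

section
/- For every strictly upper triangular matrix λ over F_q (viewed as a functional on 𝔫_n) there exists exactly one μ ∈ 𝒮_n(q) lying in the two-sided orbit U_nλU_n. In other words, 𝒮_n(q) is a complete set of representatives for the two-sided orbits of U_n on the dual space 𝔫_n*. -/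
open Matrix BigOperators
open scoped Classical

/-- Lower unitriangular matrices. -/
def IsLowerUnitri {n : ℕ} {F : Type*} [Field F] (A : Mat n F) : Prop :=
  (∀ i, A i i = 1) ∧ ∀ i j, i < j → A i j = 0

/-- Two matrices agree strictly above the diagonal, i.e. they define the same functional. -/
def UpperEq {n : ℕ} {F : Type*} (M N : Mat n F) : Prop := ∀ i j, i < j → M i j = N i j

theorem UpperEq.symm {n : ℕ} {F : Type*} {M N : Mat n F} (h : UpperEq M N) : UpperEq N M :=
  fun i j hij => (h i j hij).symm

theorem UpperEq.trans {n : ℕ} {F : Type*} {M N K : Mat n F} (h : UpperEq M N) (h' : UpperEq N K) :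
    UpperEq M K :=
  fun i j hij => (h i j hij).trans (h' i j hij)

section Orbits

variable {n : ℕ} {F : Type*} [Field F]

namespace IsLowerUnitri

theorem one : IsLowerUnitri (1 : Mat n F) :=
  ⟨fun _ => Matrix.one_apply_eq _, fun _ _ h => Matrix.one_apply_ne h.ne⟩

theorem blockTriangular {A : Mat n F} (hA : IsLowerUnitri A) :
    A.BlockTriangular OrderDual.toDual :=
  fun i j h => hA.2 i j h

theorem det_eq_one {A : Mat n F} (hA : IsLowerUnitri A) : A.det = 1 := by
  rw [Matrix.det_of_isLowerTriangular A hA.blockTriangular]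
  simp [hA.1]

theorem isUnit_det {A : Mat n F} (hA : IsLowerUnitri A) : IsUnit A.det := by
  simp [hA.det_eq_one]

theorem mul_apply_of_right {B M : Mat n F} (hB : IsLowerUnitri B) {i j : Fin n}
    (hM : ∀ l, j < l → M i l = 0) : (M * B) i j = M i j := by
  rw [Matrix.mul_apply, Finset.sum_eq_single_of_mem j (Finset.mem_univ _), hB.1, mul_one]
  intro l _ hl
  rcases lt_or_gt_of_ne hl with h | h
  · rw [hB.2 l j h, mul_zero]
  · rw [hM l h, zero_mul]

theorem mul_apply_of_above {A M : Mat n F} (hA : IsLowerUnitri A) {i j : Fin n}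
    (hM : ∀ k, k < i → M k j = 0) : (A * M) i j = M i j := by
  rw [Matrix.mul_apply, Finset.sum_eq_single_of_mem i (Finset.mem_univ _), hA.1, one_mul]
  intro k _ hk
  rcases lt_or_gt_of_ne hk with h | h
  · rw [hM k h, mul_zero]
  · rw [hA.2 i k h, zero_mul]

theorem mul {A B : Mat n F} (hA : IsLowerUnitri A) (hB : IsLowerUnitri B) :
    IsLowerUnitri (A * B) :=
  ⟨fun i => (hA.mul_apply_of_above fun k hk => hB.2 k i hk).trans (hB.1 i),
    fun _ _ h => (hA.blockTriangular.mul hB.blockTriangular) h⟩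

theorem inv {A : Mat n F} (hA : IsLowerUnitri A) : IsLowerUnitri A⁻¹ := by
  have : Invertible A := Matrix.invertibleOfIsUnitDet A hA.isUnit_det
  have hlow : ∀ i j, i < j → A⁻¹ i j = 0 := fun _ _ h =>
    Matrix.blockTriangular_inv_of_blockTriangular hA.blockTriangular h
  refine ⟨fun i => ?_, hlow⟩
  have h := hA.mul_apply_of_above fun k hk => hlow k i hk
  rw [Matrix.mul_nonsing_inv A hA.isUnit_det, Matrix.one_apply_eq] at h
  exact h.symm

theorem transvection {i j : Fin n} (h : j < i) (c : F) :
    IsLowerUnitri (Matrix.transvection i j c) := by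
  refine ⟨fun k => ?_, fun k l hkl => ?_⟩
  · have : ¬ (i = k ∧ j = k) := fun h' => h.ne (h'.2.trans h'.1.symm)
    simp [Matrix.transvection, this]
  · have : ¬ (i = k ∧ j = l) := by rintro ⟨rfl, rfl⟩; exact h.asymm hkl
    simp [Matrix.transvection, this, hkl.ne]

theorem mul_upperEq {A M N : Mat n F} (hA : IsLowerUnitri A) (h : UpperEq M N) :
    UpperEq (A * M) (A * N) := fun i j hij => by
  simp only [Matrix.mul_apply]
  refine Finset.sum_congr rfl fun k _ => ?_
  rcases lt_or_ge i k with hk | hk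
  · rw [hA.2 i k hk, zero_mul, zero_mul]
  · rw [h k j (hk.trans_lt hij)]

theorem upperEq_mul {B M N : Mat n F} (hB : IsLowerUnitri B) (h : UpperEq M N) :
    UpperEq (M * B) (N * B) := fun i j hij => by
  simp only [Matrix.mul_apply]
  refine Finset.sum_congr rfl fun k _ => ?_
  rcases lt_or_ge k j with hk | hk
  · rw [hB.2 k j hk, mul_zero, mul_zero]
  · rw [h i k (hij.trans_le hk)]

end IsLowerUnitri

theorem isLowerUnitri_transpose_iff {a : Mat n F} :
    IsLowerUnitri aᵀ ↔ a ∈ (patGroup (Plt n) : Set (Mat n F)) := by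
  refine and_congr Iff.rfl ⟨fun h i j hij hlt => h j i ?_, fun h i j hij => h j i hij.ne' ?_⟩
  · exact lt_of_le_of_ne (not_lt.mp hlt) hij.symm
  · exact hij.asymm

theorem mem_dualOrbit_iff {lam mu : Mat n F} :
    mu ∈ dualOrbit (Plt n) lam ↔ (∀ i j : Fin n, ¬ i < j → mu i j = 0) ∧
      ∃ A B : Mat n F, IsLowerUnitri A ∧ IsLowerUnitri B ∧ UpperEq mu (A * lam * B) := by
  constructor
  · rintro ⟨a, ha, b, hb, rfl⟩
    refine ⟨fun i j h => if_neg h, (a⁻¹)ᵀ, (b⁻¹)ᵀ, ?_, ?_, fun i j h => if_pos h⟩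
    · rw [Matrix.transpose_nonsing_inv]
      exact (isLowerUnitri_transpose_iff.2 ha).inv
    · rw [Matrix.transpose_nonsing_inv]
      exact (isLowerUnitri_transpose_iff.2 hb).inv
  · rintro ⟨hmu, A, B, hA, hB, h⟩
    refine ⟨(A⁻¹)ᵀ, isLowerUnitri_transpose_iff.1 (by simpa using hA.inv),
      (B⁻¹)ᵀ, isLowerUnitri_transpose_iff.1 (by simpa using hB.inv), ?_⟩
    simp only [← Matrix.transpose_nonsing_inv, Matrix.transpose_transpose,
      Matrix.nonsing_inv_nonsing_inv _ hA.isUnit_det,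
      Matrix.nonsing_inv_nonsing_inv _ hB.isUnit_det]
    ext i j
    by_cases hij : i < j
    · exact (h i j hij).trans (if_pos hij).symm
    · exact (hmu i j hij).trans (if_neg hij).symm

theorem self_mem_dualOrbit {lam : Mat n F} (hlam : ∀ i j : Fin n, ¬ i < j → lam i j = 0) :
    lam ∈ dualOrbit (Plt n) lam :=
  mem_dualOrbit_iff.2 ⟨hlam, 1, 1, .one, .one, fun i j _ => by simp⟩

theorem truncP_mul_mem_dualOrbit {lam M A : Mat n F} (hM : M ∈ dualOrbit (Plt n) lam)
    (hA : IsLowerUnitri A) : truncP (Plt n) (A * M) ∈ dualOrbit (Plt n) lam := by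
  obtain ⟨-, C, D, hC, hD, h⟩ := mem_dualOrbit_iff.1 hM
  refine mem_dualOrbit_iff.2 ⟨fun i j h => if_neg h, A * C, D, hA.mul hC, hD, fun i j hij => ?_⟩
  rw [mul_assoc A, mul_assoc A, ← hA.mul_upperEq h i j hij]
  exact if_pos hij

theorem truncP_mul_mem_dualOrbit' {lam M B : Mat n F} (hM : M ∈ dualOrbit (Plt n) lam)
    (hB : IsLowerUnitri B) : truncP (Plt n) (M * B) ∈ dualOrbit (Plt n) lam := by
  obtain ⟨-, C, D, hC, hD, h⟩ := mem_dualOrbit_iff.1 hM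
  refine mem_dualOrbit_iff.2 ⟨fun i j h => if_neg h, C, D * B, hC, hD.mul hB, fun i j hij => ?_⟩
  rw [← mul_assoc, ← hB.upperEq_mul h i j hij]
  exact if_pos hij

/-- Lower unitriangular row operations on `mu` and column operations on `nu` with a common
functional as result force `mu = nu`, by induction starting from the upper right corner. -/
theorem eq_of_upperEq_mul {mu nu A B : Mat n F} (hmu : mu ∈ Sset n F) (hnu : nu ∈ Sset n F)
    (hA : IsLowerUnitri A) (hB : IsLowerUnitri B) (h : UpperEq (A * mu) (nu * B)) :
    mu = nu := by
  have key : ∀ (t : ℕ) (i j : Fin n), i.val + (n - j.val) = t → mu i j = nu i j := by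
    intro t
    induction t using Nat.strong_induction_on with
    | _ t ih =>
      intro i j ht
      by_cases hij : i < j
      swap
      · rw [hmu.1 i j hij, hnu.1 i j hij]
      have hcol : ∀ k, k < i → mu k j = nu k j := fun k hk =>
        ih _ (by have := Fin.lt_def.1 hk; omega) k j rfl
      have hrow : ∀ l, j < l → mu i l = nu i l := fun l hl =>
        ih _ (by have := Fin.lt_def.1 hl; omega) i l rfl
      by_cases h0 : mu i j = 0 ∧ nu i j = 0
      · rw [h0.1, h0.2]
      have hzero : (∀ k, k < i → mu k j = 0) ∧ ∀ l, j < l → nu i l = 0 := by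
        rcases not_and_or.1 h0 with h1 | h1
        · exact ⟨fun k hk => by_contra fun hne => hk.ne (hmu.2.2 k i j hne h1),
            fun l hl => by_contra fun hne =>
              hl.ne (hmu.2.1 i j l h1 ((hrow l hl).trans_ne hne))⟩
        · exact ⟨fun k hk => by_contra fun hne =>
              hk.ne (hnu.2.2 k i j ((hcol k hk).symm.trans_ne hne) h1),
            fun l hl => by_contra fun hne => hl.ne (hnu.2.1 i j l h1 hne)⟩
      rw [← hA.mul_apply_of_above hzero.1, h i j hij, hB.mul_apply_of_right hzero.2]
  ext i j
  exact key _ i j rfl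

theorem eq_of_mem_dualOrbit {lam mu nu : Mat n F} (hmu : mu ∈ Sset n F) (hnu : nu ∈ Sset n F)
    (hmu' : mu ∈ dualOrbit (Plt n) lam) (hnu' : nu ∈ dualOrbit (Plt n) lam) : mu = nu := by
  obtain ⟨-, A, B, hA, hB, h⟩ := mem_dualOrbit_iff.1 hmu'
  obtain ⟨-, C, D, hC, hD, h'⟩ := mem_dualOrbit_iff.1 hnu'
  refine eq_of_upperEq_mul hmu hnu (hC.mul hA.inv) (hD.inv.mul hB) ?_
  have h1 := (hC.mul hA.inv).mul_upperEq h
  have h2 := (hD.inv.mul hB).upperEq_mul h'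
  have e1 : C * A⁻¹ * (A * lam * B) = C * lam * B := by
    simp only [mul_assoc, Matrix.nonsing_inv_mul_cancel_left _ _ hA.isUnit_det]
  have e2 : C * lam * D * (D⁻¹ * B) = C * lam * B := by
    rw [← mul_assoc, Matrix.mul_nonsing_inv_cancel_right _ _ hD.isUnit_det]
  rw [e1] at h1
  rw [e2] at h2
  exact h1.trans h2.symm

/-- If the entry of `M` at `(i, j)` is nonzero, then it is the only nonzero entry weakly
above it in its column and weakly right of it in its row. -/
def IsPivotAt (M : Mat n F) (i j : Fin n) : Prop :=
  M i j ≠ 0 → (∀ k, k < i → M k j = 0) ∧ ∀ l, j < l → M i l = 0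

theorem mem_Sset_of_isPivotAt {M : Mat n F} (hM : ∀ i j : Fin n, ¬ i < j → M i j = 0)
    (h : ∀ i j, IsPivotAt M i j) : M ∈ Sset n F := by
  refine ⟨hM, fun i j j' h1 h2 => ?_, fun i i' j h1 h2 => ?_⟩
  · by_contra hne
    rcases lt_or_gt_of_ne hne with hlt | hlt
    · exact h2 ((h i j h1).2 j' hlt)
    · exact h1 ((h i j' h2).2 j hlt)
  · by_contra hne
    rcases lt_or_gt_of_ne hne with hlt | hlt
    · exact h1 ((h i' j h2).1 i hlt)
    · exact h2 ((h i j h1).1 i' hlt)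

/-- One step of the elimination: if the positions preceding `(i, j)` (rows from top to bottom,
each row from right to left) are pivots, and `(i, j)` is not, then the entry at `(i, j)` can be
cleared without changing the other entries in the rows up to `i`. -/
theorem exists_clear_entry {lam M : Mat n F} (hM : M ∈ dualOrbit (Plt n) lam) {i j : Fin n}
    (hprev : ∀ k l, k < i ∨ k = i ∧ j < l → IsPivotAt M k l) (hij : ¬ IsPivotAt M i j) :
    ∃ N ∈ dualOrbit (Plt n) lam, N i j = 0 ∧
      ∀ k l, k ≤ i → (k, l) ≠ (i, j) → N k l = M k l := by
  have hM0 := (mem_dualOrbit_iff.1 hM).1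
  obtain ⟨hne, hbad⟩ := Classical.not_imp.1 hij
  have hlt : i < j := by_contra fun h => hne (hM0 i j h)
  by_cases hcol : ∀ k, k < i → M k j = 0
  · obtain ⟨l, hl, hMl⟩ : ∃ l, j < l ∧ M i l ≠ 0 := by
      simpa using fun h => hbad ⟨hcol, h⟩
    have habove := (hprev i l (Or.inr ⟨rfl, hl⟩) hMl).1
    refine ⟨_, truncP_mul_mem_dualOrbit' hM (.transvection hl (-(M i j / M i l))), ?_, ?_⟩
    · have : M i j + -(M i j / M i l) * M i l = 0 := by field_simp; ring
      simpa [truncP, Plt, hlt] using this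
    · intro a b ha hab
      by_cases hlt' : a < b
      · refine (if_pos hlt').trans ?_
        rcases eq_or_ne b j with rfl | hb
        · have ha' : a < i := lt_of_le_of_ne ha fun h => hab (by rw [h])
          rw [Matrix.mul_transvection_apply_same, habove a ha', mul_zero, add_zero]
        · exact Matrix.mul_transvection_apply_of_ne _ _ _ _ hb _ _
      · exact (if_neg hlt').trans (hM0 a b hlt').symm
  · obtain ⟨k, hk, hMk⟩ : ∃ k, k < i ∧ M k j ≠ 0 := by simpa using hcol
    have hrow : ∀ b, b ≠ j → M k b = 0 := by
      intro b hb
      rcases lt_or_gt_of_ne hb with h | h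
      · by_contra hkb
        exact hMk ((hprev k b (Or.inl hk) hkb).2 j h)
      · exact (hprev k j (Or.inl hk) hMk).2 b h
    refine ⟨_, truncP_mul_mem_dualOrbit hM (.transvection hk (-(M i j / M k j))), ?_, ?_⟩
    · have : M i j + -(M i j / M k j) * M k j = 0 := by field_simp; ring
      simpa [truncP, Plt, hlt] using this
    · intro a b ha hab
      by_cases hlt' : a < b
      · refine (if_pos hlt').trans ?_
        rcases eq_or_ne a i with rfl | ha'
        · have hb : b ≠ j := fun h => hab (by rw [h])
          rw [Matrix.transvection_mul_apply_same, hrow b hb, mul_zero, add_zero]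
        · exact Matrix.transvection_mul_apply_of_ne _ _ _ _ ha' _ _
      · exact (if_neg hlt').trans (hM0 a b hlt').symm

theorem exists_isPivotAt_of_lt {lam : Mat n F} (hlam : ∀ i j : Fin n, ¬ i < j → lam i j = 0)
    (t : ℕ) : ∃ M ∈ dualOrbit (Plt n) lam,
      ∀ i j : Fin n, i.val * n + (n - 1 - j.val) < t → IsPivotAt M i j := by
  have hrank : ∀ i j k l : Fin n, k < i ∨ k = i ∧ j < l →
      k.val * n + (n - 1 - l.val) < i.val * n + (n - 1 - j.val) := by
    rintro i j k l (h | ⟨rfl, h⟩)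
    · have h1 : (k.val + 1) * n ≤ i.val * n := Nat.mul_le_mul_right n h
      rw [Nat.succ_mul] at h1
      have := l.isLt
      omega
    · have := Fin.lt_def.1 h
      omega
  have htri : ∀ i j k l : Fin n,
      k.val * n + (n - 1 - l.val) ≤ i.val * n + (n - 1 - j.val) → (k, l) ≠ (i, j) →
      k < i ∨ k = i ∧ j < l := by
    intro i j k l hle hne
    by_contra hcon
    refine absurd (hrank k l i j ?_) hle.not_gt
    rcases lt_trichotomy i k with h | h | h
    · exact Or.inl h
    · refine Or.inr ⟨h, lt_of_le_of_ne (not_lt.1 fun h' => hcon (Or.inr ⟨h.symm, h'⟩)) ?_⟩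
      rintro rfl
      exact hne (by rw [h])
    · exact absurd (Or.inl h) hcon
  induction t with
  | zero => exact ⟨lam, self_mem_dualOrbit hlam, fun i j h => absurd h (Nat.not_lt_zero _)⟩
  | succ t ih =>
    obtain ⟨M, hM, hpiv⟩ := ih
    by_cases hall : ∀ i j : Fin n, i.val * n + (n - 1 - j.val) < t + 1 → IsPivotAt M i j
    · exact ⟨M, hM, hall⟩
    push Not at hall
    obtain ⟨i, j, hlt, hij⟩ := hall
    have ht : i.val * n + (n - 1 - j.val) = t :=
      (Nat.lt_succ_iff.1 hlt).antisymm (not_lt.1 fun h => hij (hpiv i j h))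
    obtain ⟨N, hN, hN0, hNM⟩ := exists_clear_entry hM
      (fun k l h => hpiv k l ((hrank i j k l h).trans_eq ht)) hij
    have hzero : ∀ k l, k ≤ i → M k l = 0 → N k l = 0 := by
      intro k l hk h0
      by_cases hkl : (k, l) = (i, j)
      · obtain ⟨rfl, rfl⟩ := Prod.mk.inj hkl
        exact hN0
      · rw [hNM k l hk hkl, h0]
    refine ⟨N, hN, fun k l hkl hne => ?_⟩
    have hkl' : (k, l) ≠ (i, j) := by
      intro h
      obtain ⟨rfl, rfl⟩ := Prod.mk.inj h
      exact hne hN0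
    have hprec := htri i j k l (by omega) hkl'
    have hk : k ≤ i := hprec.elim le_of_lt fun h => h.1.le
    have hp := hpiv k l ((hrank i j k l hprec).trans_eq ht) (by rwa [← hNM k l hk hkl'])
    exact ⟨fun a ha => hzero a l (ha.le.trans hk) (hp.1 a ha),
      fun b hb => hzero k b hk (hp.2 b hb)⟩

theorem exists_mem_Sset_dualOrbit {lam : Mat n F}
    (hlam : ∀ i j : Fin n, ¬ i < j → lam i j = 0) :
    ∃ M, M ∈ Sset n F ∧ M ∈ dualOrbit (Plt n) lam := by
  obtain ⟨M, hM, hpiv⟩ := exists_isPivotAt_of_lt hlam (n * n)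
  refine ⟨M, mem_Sset_of_isPivotAt (mem_dualOrbit_iff.1 hM).1 fun i j => hpiv i j ?_, hM⟩
  have h : (i.val + 1) * n ≤ n * n := Nat.mul_le_mul_right n i.isLt
  rw [Nat.succ_mul] at h
  have := i.isLt
  omega

end Orbits

/-- `𝒮_n(q)` is a complete set of representatives for the two-sided orbits of
`U_n` on `𝔫_n^*`: every strictly upper-triangular `λ` has exactly one `μ ∈ 𝒮_n(q)` in its
two-sided orbit `U_n λ U_n`. -/
theorem stmt1 {n : ℕ} (hn : 1 ≤ n) {F : Type*} [Field F] [Fintype F]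
    (lam : Mat n F) (hlam : ∀ i j : Fin n, ¬ i < j → lam i j = 0) :
    ∃! mu : Mat n F, mu ∈ Sset n F ∧ mu ∈ dualOrbit (Plt n) lam := by
  obtain ⟨M, hM, hM'⟩ := exists_mem_Sset_dualOrbit hlam
  exact ⟨M, ⟨hM, hM'⟩, fun N hN => eq_of_mem_dualOrbit hN.1 hM hN.2 hM'⟩
end

section
/- Let 0 < m < n. Then every superclass of U_{(m)} contains exactly one path superclass representative; that is, for each u ∈ U_{(m)} there is a unique path superclass representative v ∈ U_{(m)} with u − 1 ∈ U_{(m)}(v−1)U_{(m)}. -/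
open Matrix BigOperators
open scoped Classical

section Reps

variable {n : ℕ} {F : Type*} [Field F] [Fintype F]

/-- The vertex-set shape (in 1-based coordinates `(v.1.val + 1, v.2.val + 1)`) of the large
connected component of a comb superclass representative:
`{(1,k_1),…,(1,k_r)} ∪ {(i_1,k_1),…,(i_{r'},k_{r'})}` with
`1 ≤ i_{r'} < ⋯ < i_1 ≤ m < k_1 < ⋯ < k_r ≤ n` and `r' ∈ {r−1, r}`. -/
def CombClassComp (m : ℕ) (S : Set (Fin n × Fin n)) : Prop :=
  ∃ r r' : ℕ, (r' = r ∨ r' + 1 = r) ∧ 1 ≤ r' ∧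
    ∃ i k : ℕ → ℕ,
      (∀ d, 1 ≤ d → d < r' → i (d + 1) < i d) ∧ 1 ≤ i r' ∧ i 1 ≤ m ∧
      m < k 1 ∧ (∀ d, 1 ≤ d → d < r → k d < k (d + 1)) ∧ k r ≤ n ∧
      S = {v : Fin n × Fin n |
        (v.1.val + 1 = 1 ∧ ∃ d, 1 ≤ d ∧ d ≤ r ∧ v.2.val + 1 = k d) ∨
        (∃ d, 1 ≤ d ∧ d ≤ r' ∧ v.1.val + 1 = i d ∧ v.2.val + 1 = k d)}

/-- `u ∈ U_(m)` is a comb superclass representative (the condition is on `A = u − 1`):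
at most one connected component of `G_A` has more than one vertex, and any such component has
the comb shape. -/
def IsCombClassRep (m : ℕ) (A : Mat n F) : Prop :=
  AtMostOneBig A ∧
    ∀ p : Fin n × Fin n, A p.1 p.2 ≠ 0 → 1 < (compOf A p).ncard →
      CombClassComp m (compOf A p)

/-- The vertex-set shape of the large connected component of a path superclass representative:
`{(1,k_1)} ∪ {(i_d,k_d) : 1 ≤ d ≤ r−1} ∪ {(i_d,k_{d+1}) : 1 ≤ d ≤ r−1} ∪ E` with `E = ∅` or
`E = {(i_r,k_r)}`, where `1 < i_{r'} < ⋯ < i_1 ≤ m < k_1 < ⋯ < k_r ≤ n`, and `r' = r` if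
`E ≠ ∅`, `r' = r − 1` if `E = ∅` (`e : Bool` records whether `E ≠ ∅`). -/
def PathClassComp (m : ℕ) (S : Set (Fin n × Fin n)) : Prop :=
  ∃ (r : ℕ) (e : Bool) (i k : ℕ → ℕ),
    1 ≤ r ∧
    (∀ d, 1 ≤ d → d < (if e then r else r - 1) → i (d + 1) < i d) ∧
    1 < i (if e then r else r - 1) ∧ i 1 ≤ m ∧
    m < k 1 ∧ (∀ d, 1 ≤ d → d < r → k d < k (d + 1)) ∧ k r ≤ n ∧
    S = {v : Fin n × Fin n |
      (v.1.val + 1 = 1 ∧ v.2.val + 1 = k 1) ∨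
      (∃ d, 1 ≤ d ∧ d ≤ r - 1 ∧ v.1.val + 1 = i d ∧ v.2.val + 1 = k d) ∨
      (∃ d, 1 ≤ d ∧ d ≤ r - 1 ∧ v.1.val + 1 = i d ∧ v.2.val + 1 = k (d + 1)) ∨
      (e = true ∧ v.1.val + 1 = i r ∧ v.2.val + 1 = k r)}

/-- `u ∈ U_(m)` is a path superclass representative (the condition is on `A = u − 1`). -/
def IsPathClassRep (m : ℕ) (A : Mat n F) : Prop :=
  AtMostOneBig A ∧
    ∀ p : Fin n × Fin n, A p.1 p.2 ≠ 0 → 1 < (compOf A p).ncard →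
      PathClassComp m (compOf A p)

/-- The vertex-set shape of the large connected component of a comb supercharacter
representative: `{(1,k_1)} ∪ {(i_d,k_{d+1}) : 1 ≤ d ≤ r−1} ∪ {(i_d,k_1) : 1 ≤ d ≤ r'}` with
`n ≥ k_1 > k_2 > ⋯ > k_r > m ≥ i_{r'} > ⋯ > i_1 > 1` and `r' ∈ {r−1, r}`. -/
def CombCharComp (m : ℕ) (S : Set (Fin n × Fin n)) : Prop :=
  ∃ r r' : ℕ, (r' = r ∨ r' + 1 = r) ∧ 1 ≤ r' ∧
    ∃ i k : ℕ → ℕ,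
      (∀ d, 1 ≤ d → d < r → k (d + 1) < k d) ∧ m < k r ∧ k 1 ≤ n ∧
      (∀ d, 1 ≤ d → d < r' → i d < i (d + 1)) ∧ i r' ≤ m ∧ 1 < i 1 ∧
      S = {v : Fin n × Fin n |
        (v.1.val + 1 = 1 ∧ v.2.val + 1 = k 1) ∨
        (∃ d, 1 ≤ d ∧ d ≤ r - 1 ∧ v.1.val + 1 = i d ∧ v.2.val + 1 = k (d + 1)) ∨
        (∃ d, 1 ≤ d ∧ d ≤ r' ∧ v.1.val + 1 = i d ∧ v.2.val + 1 = k 1)}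

/-- `λ ∈ 𝔫_(m)^*` is a comb supercharacter representative. -/
def IsCombCharRep (m : ℕ) (A : Mat n F) : Prop :=
  AtMostOneBig A ∧
    ∀ p : Fin n × Fin n, A p.1 p.2 ≠ 0 → 1 < (compOf A p).ncard →
      CombCharComp m (compOf A p)

/-- The vertex-set shape of the large connected component of a path supercharacter
representative: `{(1,k_1)} ∪ {(i_d,k_d) : 1 ≤ d ≤ r−1} ∪ {(i_d,k_{d+1}) : 1 ≤ d ≤ r−1} ∪ E`
with `E = ∅` or `E = {(i_r,k_r)}`, where `n ≥ k_1 > ⋯ > k_r > m ≥ i_{r'} > ⋯ > i_1 > 1`, and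
`r' = r` if `E ≠ ∅`, `r' = r − 1` if `E = ∅`. -/
def PathCharComp (m : ℕ) (S : Set (Fin n × Fin n)) : Prop :=
  ∃ (r : ℕ) (e : Bool) (i k : ℕ → ℕ),
    1 ≤ r ∧
    (∀ d, 1 ≤ d → d < r → k (d + 1) < k d) ∧ m < k r ∧ k 1 ≤ n ∧
    (∀ d, 1 ≤ d → d < (if e then r else r - 1) → i d < i (d + 1)) ∧
    i (if e then r else r - 1) ≤ m ∧ 1 < i 1 ∧
    S = {v : Fin n × Fin n |
      (v.1.val + 1 = 1 ∧ v.2.val + 1 = k 1) ∨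
      (∃ d, 1 ≤ d ∧ d ≤ r - 1 ∧ v.1.val + 1 = i d ∧ v.2.val + 1 = k d) ∨
      (∃ d, 1 ≤ d ∧ d ≤ r - 1 ∧ v.1.val + 1 = i d ∧ v.2.val + 1 = k (d + 1)) ∨
      (e = true ∧ v.1.val + 1 = i r ∧ v.2.val + 1 = k r)}

/-- `λ ∈ 𝔫_(m)^*` is a path supercharacter representative. -/
def IsPathCharRep (m : ℕ) (A : Mat n F) : Prop :=
  AtMostOneBig A ∧
    ∀ p : Fin n × Fin n, A p.1 p.2 ≠ 0 → 1 < (compOf A p).ncard →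
      PathCharComp m (compOf A p)

end Reps

section PatternGroup

variable {n m : ℕ} {F : Type*} [Field F]

lemma Pm_trans {i j k : Fin n} (h₁ : Pm n m i j) (h₂ : Pm n m j k) : Pm n m i k :=
  ⟨h₁.1.trans h₂.1, fun hi => (h₁.2 hi).trans (Nat.succ_lt_succ h₂.1)⟩

/-- The matrices of the nilpotent algebra `𝔫_(m)`: those supported on the positions of `Pm`. -/
def PmSupported (m : ℕ) (A : Mat n F) : Prop :=
  ∀ i j, A i j ≠ 0 → Pm n m i j

lemma patGroup_eq_or {a : Mat n F} (ha : a ∈ patGroup (Pm n m)) {i j : Fin n}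
    (h : a i j ≠ 0) : i = j ∨ Pm n m i j := by
  by_contra hc
  push Not at hc
  exact h (ha.2 i j hc.1 hc.2)

lemma patGroup_le {a : Mat n F} (ha : a ∈ patGroup (Pm n m)) {i j : Fin n}
    (h : a i j ≠ 0) : i ≤ j := by
  rcases patGroup_eq_or ha h with rfl | h
  · exact le_rfl
  · exact h.1.le

lemma one_mem_patGroup : (1 : Mat n F) ∈ patGroup (Pm n m) :=
  ⟨fun i => by simp, fun i j h _ => by simp [h]⟩

lemma mem_patGroup_iff_sub_one {a : Mat n F} :
    a ∈ patGroup (Pm n m) ↔ PmSupported m (a - 1) := by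
  constructor
  · intro ha i j h
    by_cases hij : i = j
    · subst hij
      simp [ha.1 i] at h
    · have : a i j ≠ 0 := by simpa [hij] using h
      exact (patGroup_eq_or ha this).resolve_left hij
  · intro h
    refine ⟨fun i => ?_, fun i j hij hP => ?_⟩
    · by_contra hc
      have : (a - 1) i i ≠ 0 := by simpa [sub_eq_zero] using hc
      exact lt_irrefl _ (h i i this).1
    · by_contra hc
      exact hP (h i j (by simpa [hij] using hc))

lemma PmSupported.mul_left {a A : Mat n F} (ha : a ∈ patGroup (Pm n m))
    (hA : PmSupported m A) : PmSupported m (a * A) := by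
  intro i k h
  rw [Matrix.mul_apply] at h
  obtain ⟨j, -, hj⟩ := Finset.exists_ne_zero_of_sum_ne_zero h
  rcases patGroup_eq_or ha (left_ne_zero_of_mul hj) with rfl | h1
  · exact hA _ _ (right_ne_zero_of_mul hj)
  · exact Pm_trans h1 (hA _ _ (right_ne_zero_of_mul hj))

lemma PmSupported.mul_right {b A : Mat n F} (hb : b ∈ patGroup (Pm n m))
    (hA : PmSupported m A) : PmSupported m (A * b) := by
  intro i k h
  rw [Matrix.mul_apply] at h
  obtain ⟨j, -, hj⟩ := Finset.exists_ne_zero_of_sum_ne_zero h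
  rcases patGroup_eq_or hb (right_ne_zero_of_mul hj) with rfl | h1
  · exact hA _ _ (left_ne_zero_of_mul hj)
  · exact Pm_trans (hA _ _ (left_ne_zero_of_mul hj)) h1

lemma PmSupported.add {A B : Mat n F} (hA : PmSupported m A) (hB : PmSupported m B) :
    PmSupported m (A + B) := by
  intro i j h
  by_cases h1 : A i j = 0
  · exact hB i j (by simpa [h1] using h)
  · exact hA i j h1

lemma mul_mem_patGroup {a b : Mat n F} (ha : a ∈ patGroup (Pm n m))
    (hb : b ∈ patGroup (Pm n m)) : a * b ∈ patGroup (Pm n m) := by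
  rw [mem_patGroup_iff_sub_one]
  have : a * b - 1 = (a - 1) * b + (b - 1) := by noncomm_ring
  rw [this]
  exact ((mem_patGroup_iff_sub_one.1 ha).mul_right hb).add (mem_patGroup_iff_sub_one.1 hb)

lemma pow_mem_patGroup {a : Mat n F} (ha : a ∈ patGroup (Pm n m)) (k : ℕ) :
    a ^ k ∈ patGroup (Pm n m) := by
  induction k with
  | zero => simpa using one_mem_patGroup
  | succ k ih => rw [pow_succ]; exact mul_mem_patGroup ih ha

lemma det_of_mem_patGroup {a : Mat n F} (ha : a ∈ patGroup (Pm n m)) : a.det = 1 := by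
  have h : a.BlockTriangular id := fun i j hij => by
    by_contra hc
    exact absurd (patGroup_le ha hc) (not_le.2 hij)
  rw [Matrix.det_of_isUpperTriangular h]
  simp [ha.1]

lemma exists_inv_mem_patGroup [Finite F] {a : Mat n F} (ha : a ∈ patGroup (Pm n m)) :
    ∃ a' ∈ (patGroup (Pm n m) : Set (Mat n F)), a' * a = 1 ∧ a * a' = 1 := by
  obtain ⟨u, rfl⟩ : IsUnit a := (Matrix.isUnit_iff_isUnit_det a).2 (by
    rw [det_of_mem_patGroup ha]; exact isUnit_one)
  have hpos : 0 < orderOf u := orderOf_pos u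
  have h : u ^ (orderOf u - 1) * u = 1 := by
    rw [← pow_succ, Nat.sub_add_cancel hpos, pow_orderOf_eq_one]
  have h' : u * u ^ (orderOf u - 1) = 1 := by
    rw [← pow_succ', Nat.sub_add_cancel hpos, pow_orderOf_eq_one]
  refine ⟨(u : Mat n F) ^ (orderOf u - 1), pow_mem_patGroup ha _, ?_, ?_⟩
  · simpa using congrArg Units.val h
  · simpa using congrArg Units.val h'

lemma transvection_mem_patGroup {i j : Fin n} (h : Pm n m i j) (c : F) :
    Matrix.transvection i j c ∈ patGroup (Pm n m) := by
  rw [mem_patGroup_iff_sub_one]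
  intro x y hxy
  rw [Matrix.transvection, add_sub_cancel_left, Matrix.single_apply] at hxy
  split_ifs at hxy with hc
  · rwa [← hc.1, ← hc.2]
  · exact absurd rfl hxy

/-- Two matrices in the same two-sided orbit of `U_(m)`. -/
def SameOrbit (m : ℕ) (A B : Mat n F) : Prop :=
  ∃ a ∈ (patGroup (Pm n m) : Set (Mat n F)), ∃ b ∈ (patGroup (Pm n m) : Set (Mat n F)),
    B = a * A * b

lemma SameOrbit.refl (A : Mat n F) : SameOrbit m A A :=
  ⟨1, one_mem_patGroup, 1, one_mem_patGroup, by simp⟩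

lemma SameOrbit.trans {A B C : Mat n F} (h₁ : SameOrbit m A B) (h₂ : SameOrbit m B C) :
    SameOrbit m A C := by
  obtain ⟨a, ha, b, hb, rfl⟩ := h₁
  obtain ⟨a', ha', b', hb', rfl⟩ := h₂
  exact ⟨a' * a, mul_mem_patGroup ha' ha, b * b', mul_mem_patGroup hb hb', by
    simp only [Matrix.mul_assoc]⟩

lemma SameOrbit.symm [Finite F] {A B : Mat n F} (h : SameOrbit m A B) : SameOrbit m B A := by
  obtain ⟨a, ha, b, hb, rfl⟩ := h
  obtain ⟨a', ha', h1, -⟩ := exists_inv_mem_patGroup ha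
  obtain ⟨b', hb', -, h2⟩ := exists_inv_mem_patGroup hb
  refine ⟨a', ha', b', hb', ?_⟩
  calc A = (a' * a) * A * (b * b') := by rw [h1, h2]; simp
    _ = a' * (a * A * b) * b' := by simp only [Matrix.mul_assoc]

lemma SameOrbit.pmSupported {A B : Mat n F} (h : SameOrbit m A B) (hA : PmSupported m A) :
    PmSupported m B := by
  obtain ⟨a, ha, b, hb, rfl⟩ := h
  exact (hA.mul_left ha).mul_right hb

end PatternGroup

section Comb

variable {n m : ℕ} {F : Type*} [Field F]

/-- Comb matrices: off the first row `z` there is at most one nonzero entry in each row and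
column, the columns supporting the first row have no other entry at or below the row of index `m`,
and from left to right their other entries move strictly upwards (with none allowed only in the
last such column). -/
structure IsComb (m : ℕ) (z : Fin n) (C : Mat n F) : Prop where
  supp : PmSupported m C
  row : ∀ i j j', i ≠ z → C i j ≠ 0 → C i j' ≠ 0 → j = j'
  col : ∀ i i' j, i ≠ z → i' ≠ z → C i j ≠ 0 → C i' j ≠ 0 → i = i'
  low : ∀ i j, C z j ≠ 0 → i ≠ z → C i j ≠ 0 → i.val < m
  anti : ∀ j k, j < k → C z j ≠ 0 → C z k ≠ 0 →
    ∃ i, i ≠ z ∧ C i j ≠ 0 ∧ ∀ i', i' ≠ z → C i' k ≠ 0 → i' < i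

/-- If `D b = a C` with `a`, `b` unitriangular, and `C`, `D` have at most one nonzero entry in each
row and column off the first row, then `C` and `D` agree off the first row. -/
lemma eq_off_first_row {z : Fin n} (hz : ∀ i, z ≤ i) {C D a b : Mat n F}
    (hC : IsComb m z C) (hD : IsComb m z D)
    (ha : a ∈ patGroup (Pm n m)) (hb : b ∈ patGroup (Pm n m)) (h : D * b = a * C) :
    ∀ (N : ℕ) (x j : Fin n), n - x.val + j.val < N → x ≠ z → D x j = C x j := by
  intro N
  induction N with
  | zero => intro x j h; omega
  | succ N ih =>
    intro x j hN hx
    have hne : ∀ y, x < y → y ≠ z := fun y hy => ((hz x).trans_lt hy).ne'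
    by_cases h1 : ∃ y, x < y ∧ C y j ≠ 0
    · obtain ⟨y, hxy, hy⟩ := h1
      have e := ih y j (by have := y.2; omega) (hne y hxy)
      have c0 : C x j = 0 := by
        by_contra hc
        exact hxy.ne (hC.col _ _ _ hx (hne y hxy) hc hy)
      have d0 : D x j = 0 := by
        by_contra hc
        exact hxy.ne (hD.col _ _ _ hx (hne y hxy) hc (e ▸ hy))
      rw [c0, d0]
    by_cases h2 : ∃ l, l < j ∧ D x l ≠ 0
    · obtain ⟨l, hlj, hl⟩ := h2
      have e := ih x l (by omega) hx
      have d0 : D x j = 0 := by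
        by_contra hc
        exact hlj.ne (hD.row _ _ _ hx hl hc)
      have c0 : C x j = 0 := by
        by_contra hc
        exact hlj.ne (hC.row _ _ _ hx (e ▸ hl) hc)
      rw [c0, d0]
    push Not at h1 h2
    have h3 : (D * b) x j = D x j := by
      rw [Matrix.mul_apply, Finset.sum_eq_single j]
      · rw [hb.1, mul_one]
      · intro l _ hlj
        by_contra hc
        exact left_ne_zero_of_mul hc
          (h2 l (lt_of_le_of_ne (patGroup_le hb (right_ne_zero_of_mul hc)) hlj))
      · simp
    have h4 : (a * C) x j = C x j := by
      rw [Matrix.mul_apply, Finset.sum_eq_single x]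
      · rw [ha.1, one_mul]
      · intro y _ hyx
        by_contra hc
        exact right_ne_zero_of_mul hc
          (h1 y (lt_of_le_of_ne (patGroup_le ha (left_ne_zero_of_mul hc)) hyx.symm))
      · simp
    rw [← h3, ← h4, h]

/-- A two-sided orbit contains at most one comb matrix. -/
theorem IsComb.eq_of_sameOrbit [Finite F] {z : Fin n} (hz : ∀ i, z ≤ i) (hz0 : z.val = 0)
    {C D : Mat n F} (hC : IsComb m z C) (hD : IsComb m z D) (h : SameOrbit m C D) : D = C := by
  obtain ⟨a, ha, b', hb', rfl⟩ := h
  obtain ⟨b, hb, -, hbb⟩ := exists_inv_mem_patGroup hb'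
  generalize hDef : a * C * b' = D at hD
  have h : D * b = a * C := by rw [← hDef, Matrix.mul_assoc, hbb, Matrix.mul_one]
  have hoff : ∀ x j, x ≠ z → D x j = C x j := fun x j hx =>
    eq_off_first_row hz hC hD ha hb h _ x j (Nat.lt_succ_self _) hx
  have hbx : ∀ x j k, x ≠ z → D x j ≠ 0 → b j k ≠ 0 → ∃ y, y ≠ z ∧ x ≤ y ∧ C y k ≠ 0 := by
    intro x j k hx hxj hjk
    have e : (D * b) x k = D x j * b j k := by
      rw [Matrix.mul_apply]
      refine Finset.sum_eq_single j (fun l _ hl => ?_) (by simp)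
      by_contra hc
      exact hl (hD.row _ _ _ hx (left_ne_zero_of_mul hc) hxj)
    have e' : (a * C) x k ≠ 0 := by
      rw [← h, e]; exact mul_ne_zero hxj hjk
    rw [Matrix.mul_apply] at e'
    obtain ⟨y, -, hy⟩ := Finset.exists_ne_zero_of_sum_ne_zero e'
    have hxy := patGroup_le ha (left_ne_zero_of_mul hy)
    exact ⟨y, fun hyz => hx (le_antisymm (hyz ▸ hxy) (hz x)), hxy, right_ne_zero_of_mul hy⟩
  have hrow : ∀ (N : ℕ) (k : Fin n), k.val < N → D z k = C z k := by
    intro N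
    induction N with
    | zero => intro k hk; omega
    | succ N ih =>
      intro k hk
      by_cases h0 : C z k = 0 ∧ D z k = 0
      · rw [h0.1, h0.2]
      have hlow : ∀ y, y ≠ z → C y k ≠ 0 → y.val < m := by
        intro y hy hyk
        by_cases hc : C z k = 0
        · exact hD.low y k (fun hd => h0 ⟨hc, hd⟩) hy (by rwa [hoff y k hy])
        · exact hC.low y k hc hy hyk
      have hanti : ∀ l, l < k → D z l ≠ 0 →
          ∃ i, i ≠ z ∧ D i l ≠ 0 ∧ ∀ i', i' ≠ z → C i' k ≠ 0 → i' < i := by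
        intro l hlk hl
        by_cases hc : C z k = 0
        · obtain ⟨i, hi, hil, hi'⟩ := hD.anti l k hlk hl (fun hd => h0 ⟨hc, hd⟩)
          exact ⟨i, hi, hil, fun i' h1 h2 => hi' i' h1 (by rwa [hoff i' k h1])⟩
        · obtain ⟨i, hi, hil, hi'⟩ := hC.anti l k hlk
            (by rwa [← ih l (by have : l.val < k.val := hlk; omega)]) hc
          exact ⟨i, hi, by rwa [hoff i l hi], hi'⟩
      have h3 : (D * b) z k = D z k := by
        rw [Matrix.mul_apply, Finset.sum_eq_single k]
        · rw [hb.1, mul_one]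
        · intro l _ hlk
          by_contra hc
          have hl := left_ne_zero_of_mul hc
          have hb0 := right_ne_zero_of_mul hc
          obtain ⟨i, hi, hil, hi'⟩ := hanti l (lt_of_le_of_ne (patGroup_le hb hb0) hlk) hl
          obtain ⟨y, hy, hiy, hyk⟩ := hbx i l k hi hil hb0
          exact absurd (hi' y hy hyk) (not_lt.2 hiy)
        · simp
      have h4 : (a * C) z k = C z k := by
        rw [Matrix.mul_apply, Finset.sum_eq_single z]
        · rw [ha.1, one_mul]
        · intro y _ hyz
          by_contra hc
          have h5 := (patGroup_eq_or ha (left_ne_zero_of_mul hc)).resolve_left hyz.symm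
          have h6 := h5.2 hz0
          have h7 := hlow y hyz (right_ne_zero_of_mul hc)
          omega
        · simp
      rw [← h3, ← h4, h]
  ext x j
  by_cases hx : x = z
  · subst hx; exact hrow _ j (Nat.lt_succ_self _)
  · exact hoff x j hx

end Comb

section CombExistence

variable {n m : ℕ} {F : Type*} [Field F]

/-- Row reduction order: rows from bottom to top, each row from left to right. -/
def ReductionLT (p q : Fin n × Fin n) : Prop :=
  q.1 < p.1 ∨ p.1 = q.1 ∧ p.2 < q.2

/-- The position of `p` in the row reduction order. -/
def reductionRank (p : Fin n × Fin n) : ℕ := (n - 1 - p.1.val) * n + p.2.val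

lemma reductionRank_lt {p q : Fin n × Fin n} (h : ReductionLT p q) :
    reductionRank p < reductionRank q := by
  unfold reductionRank
  have hp := p.2.2
  have hp1 := p.1.2
  have hq1 := q.1.2
  rcases h with h | ⟨h, h'⟩
  · have h : q.1.val < p.1.val := h
    have : n - 1 - p.1.val + 1 ≤ n - 1 - q.1.val := by omega
    have := Nat.mul_le_mul_right n this
    rw [Nat.add_mul] at this
    omega
  · have h' : p.2.val < q.2.val := h'
    rw [h]
    omega

lemma reductionLT_trichotomy (p q : Fin n × Fin n) :
    ReductionLT p q ∨ p = q ∨ ReductionLT q p := by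
  unfold ReductionLT
  rcases lt_trichotomy p.1 q.1 with h | h | h
  · exact .inr (.inr (.inl h))
  · rcases lt_trichotomy p.2 q.2 with h' | h' | h'
    · exact .inl (.inr ⟨h, h'⟩)
    · exact .inr (.inl (Prod.ext h h'))
    · exact .inr (.inr (.inr ⟨h.symm, h'⟩))
  · exact .inl (.inl h)

/-- The entry at `p` either vanishes or cannot be cleared using entries preceding it in the row
reduction order. -/
def IsReducedAt (m : ℕ) (z : Fin n) (C : Mat n F) (p : Fin n × Fin n) : Prop :=
  C p.1 p.2 ≠ 0 →
    (p.1 ≠ z → (∀ y, p.1 < y → C y p.2 = 0) ∧ ∀ l, l < p.2 → C p.1 l = 0) ∧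
    (p.1 = z → (∀ y, y ≠ z → m ≤ y.val → C y p.2 = 0) ∧
      ∀ l, l < p.2 → C z l ≠ 0 →
        ∃ i, i ≠ z ∧ C i l ≠ 0 ∧ ∀ i', i' ≠ z → C i' p.2 ≠ 0 → i' < i)

lemma IsReducedAt.congr {z : Fin n} (hz : ∀ i, z ≤ i) {C D : Mat n F} {p : Fin n × Fin n}
    (h : ∀ q, ReductionLT q p ∨ q = p → D q.1 q.2 = C q.1 q.2) (hC : IsReducedAt m z C p) :
    IsReducedAt m z D p := by
  intro h0
  obtain ⟨h1, h2⟩ := hC (by rwa [← h p (.inr rfl)])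
  refine ⟨fun hp => ⟨fun y hy => ?_, fun l hl => ?_⟩, fun hp => ?_⟩
  · rw [h (y, p.2) (.inl (.inl hy))]
    exact (h1 hp).1 y hy
  · rw [h (p.1, l) (.inl (.inr ⟨rfl, hl⟩))]
    exact (h1 hp).2 l hl
  · have hoff : ∀ y l, y ≠ z → D y l = C y l := fun y l hy =>
      h (y, l) (.inl (.inl (hp ▸ lt_of_le_of_ne (hz y) hy.symm)))
    refine ⟨fun y hy hm => ?_, fun l hl hzl => ?_⟩
    · rw [hoff y _ hy]
      exact (h2 hp).1 y hy hm
    · obtain ⟨i, hi, hil, hi'⟩ := (h2 hp).2 l hl (by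
        rwa [← h (z, l) (.inl (.inr ⟨hp.symm, hl⟩))])
      exact ⟨i, hi, by rwa [hoff i l hi], fun i' h3 h4 => hi' i' h3 (by rwa [← hoff i' _ h3])⟩

lemma SameOrbit.transvection_left {i j : Fin n} (h : Pm n m i j) (c : F) (A : Mat n F) :
    SameOrbit m A (Matrix.transvection i j c * A) :=
  ⟨_, transvection_mem_patGroup h c, 1, one_mem_patGroup, by simp⟩

lemma SameOrbit.transvection_right {i j : Fin n} (h : Pm n m i j) (c : F) (A : Mat n F) :
    SameOrbit m A (A * Matrix.transvection i j c) :=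
  ⟨1, one_mem_patGroup, _, transvection_mem_patGroup h c, by simp⟩

/-- A nonzero entry which is not reduced can be cleared without changing preceding entries. -/
lemma exists_clear_entry_s7 {z : Fin n} (hz : ∀ i, z ≤ i) (hz0 : z.val = 0)
    {C : Mat n F} (hC : PmSupported m C) {p : Fin n × Fin n}
    (hprev : ∀ q, ReductionLT q p → IsReducedAt m z C q) (hp : ¬ IsReducedAt m z C p) :
    ∃ D, SameOrbit m C D ∧ D p.1 p.2 = 0 ∧ ∀ q, ReductionLT q p → D q.1 q.2 = C q.1 q.2 := by
  obtain ⟨x, j⟩ := p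
  simp only [IsReducedAt, Classical.not_imp] at hp
  obtain ⟨hxj, hp⟩ := hp
  have hpm : ∀ {y k : Fin n}, y ≠ z → y < k → Pm n m y k := fun hy hyk =>
    ⟨hyk, fun h => absurd (Fin.ext (h.trans hz0.symm)) hy⟩
  have hrow : ∀ (y : Fin n), x < y → C y j ≠ 0 → ∀ l, l < j → C y l = 0 := by
    intro y hy hyj l hl
    exact ((hprev (y, j) (.inl hy) hyj).1 ((hz x).trans_lt hy).ne').2 l hl
  have hrowop : ∀ y, Pm n m x y → C y j ≠ 0 →
      ∃ D, SameOrbit m C D ∧ D x j = 0 ∧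
        ∀ q, ReductionLT q (x, j) → D q.1 q.2 = C q.1 q.2 := by
    intro y hxy hyj
    refine ⟨_, SameOrbit.transvection_left hxy (-(C x j / C y j)) C, ?_, ?_⟩
    · rw [Matrix.transvection_mul_apply_same]
      field_simp
      ring
    · rintro ⟨y', l⟩ h
      rcases h with h | ⟨h, h'⟩
      · exact Matrix.transvection_mul_apply_of_ne _ _ _ _ (ne_of_gt h) _ _
      · simp only at h h' ⊢
        subst h
        rw [Matrix.transvection_mul_apply_same, hrow y hxy.1 hyj l h', mul_zero, add_zero]
  by_cases hx : x = z
  · subst hx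
    have hp' : ¬ ((∀ y, y ≠ x → m ≤ y.val → C y j = 0) ∧
      ∀ l, l < j → C x l ≠ 0 →
        ∃ i, i ≠ x ∧ C i l ≠ 0 ∧ ∀ i', i' ≠ x → C i' j ≠ 0 → i' < i) := fun h =>
      hp ⟨fun h' => absurd rfl h', fun _ => h⟩
    by_cases h1 : ∃ y, y ≠ x ∧ m ≤ y.val ∧ C y j ≠ 0
    · obtain ⟨y, hyx, hmy, hyj⟩ := h1
      exact hrowop y ⟨lt_of_le_of_ne (hz y) hyx.symm, fun _ => Nat.lt_succ_of_le hmy⟩ hyj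
    push Not at h1
    have h2 : ∃ l, l < j ∧ C x l ≠ 0 ∧
        ∀ i, i ≠ x → C i l ≠ 0 → ∃ i', i' ≠ x ∧ C i' j ≠ 0 ∧ i ≤ i' := by
      by_contra hc
      push Not at hc
      exact hp' ⟨h1, hc⟩
    obtain ⟨l, hlj, hxl, hl⟩ := h2
    have hlx : l ≠ x := (hC x l hxl).1.ne'
    have hcol := SameOrbit.transvection_right (hpm hlx hlj) (-(C x j / C x l)) C
    by_cases h3 : ∃ i, i ≠ x ∧ C i l ≠ 0
    · obtain ⟨i, hi, hil⟩ := h3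
      obtain ⟨i', hi', hi'j, hii'⟩ := hl i hi hil
      have hgt : ∀ {y}, y ≠ x → x < y := fun hy => lt_of_le_of_ne (hz _) hy.symm
      have hi'l : C i' l = 0 := hrow i' (hgt hi') hi'j l hlj
      have hlt : i < i' := lt_of_le_of_ne hii' (by rintro rfl; exact hil hi'l)
      have huniq : ∀ y, y ≠ x → y ≠ i → C y l = 0 := by
        intro y hy hyi
        by_contra hc
        rcases lt_or_gt_of_ne hyi with h | h
        · exact hil (((hprev (y, l) (.inl (hgt hy)) hc).1 hy).1 i h)
        · exact hc (((hprev (i, l) (.inl (hgt hi)) hil).1 hi).1 y h)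
      have hi'row : ∀ k, k ≠ j → C i' k = 0 := by
        intro k hk
        rcases lt_or_gt_of_ne hk with h | h
        · exact hrow i' (hgt hi') hi'j k h
        · by_contra hc
          exact hi'j (((hprev (i', k) (.inl (hgt hi')) hc).1 hi').2 j h)
      set D := C * Matrix.transvection l j (-(C x j / C x l)) with hD
      have hDj : ∀ y, D y j = C y j + -(C x j / C x l) * C y l := fun y =>
        Matrix.mul_transvection_apply_same _ _ _ _ _
      have hDk : ∀ y k, k ≠ j → D y k = C y k := fun y k hk =>
        Matrix.mul_transvection_apply_of_ne _ _ _ _ hk _ _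
      refine ⟨_, hcol.trans (SameOrbit.transvection_left (hpm hi hlt)
        (C x j / C x l * C i l / C i' j) _), ?_, ?_⟩
      · rw [Matrix.transvection_mul_apply_of_ne _ _ _ _ hi.symm, hDj]
        field_simp
        ring
      · rintro ⟨y, k⟩ h
        simp only
        by_cases hyi : y = i
        · subst hyi
          rw [Matrix.transvection_mul_apply_same]
          by_cases hk : k = j
          · subst hk
            rw [hDj, hDj, hi'l]
            field_simp
            ring
          · rw [hDk _ _ hk, hDk _ _ hk, hi'row k hk]
            ring
        · rw [Matrix.transvection_mul_apply_of_ne _ _ _ _ hyi]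
          by_cases hk : k = j
          · subst hk
            have hy : y ≠ x := by
              rcases h with h | ⟨h, h'⟩
              · exact ne_of_gt h
              · exact absurd h' (lt_irrefl _)
            rw [hDj, huniq y hy hyi]
            ring
          · exact hDk _ _ hk
    · push Not at h3
      refine ⟨_, hcol, ?_, ?_⟩
      · rw [Matrix.mul_transvection_apply_same]
        field_simp
        ring
      · rintro ⟨y, k⟩ h
        simp only
        by_cases hk : k = j
        · subst hk
          have hy : y ≠ x := by
            rcases h with h | ⟨h, h'⟩
            · exact ne_of_gt h
            · exact absurd h' (lt_irrefl _)
          rw [Matrix.mul_transvection_apply_same, h3 y hy]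
          ring
        · exact Matrix.mul_transvection_apply_of_ne _ _ _ _ hk _ _
  · by_cases h1 : ∃ y, x < y ∧ C y j ≠ 0
    · obtain ⟨y, hxy, hyj⟩ := h1
      exact hrowop y (hpm hx hxy) hyj
    push Not at h1
    have h2 : ∃ l, l < j ∧ C x l ≠ 0 := by
      by_contra hc
      push Not at hc
      exact hp ⟨fun _ => ⟨h1, hc⟩, fun h => absurd h hx⟩
    obtain ⟨l, hlj, hxl⟩ := h2
    have hlz : l ≠ z := ((hz x).trans_lt (hC x l hxl).1).ne'
    refine ⟨_, SameOrbit.transvection_right (hpm hlz hlj) (-(C x j / C x l)) C, ?_, ?_⟩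
    · rw [Matrix.mul_transvection_apply_same]
      field_simp
      ring
    · rintro ⟨y, k⟩ h
      simp only
      by_cases hk : k = j
      · subst hk
        have hxy : x < y := by
          rcases h with h | ⟨h, h'⟩
          · exact h
          · exact absurd h' (lt_irrefl _)
        rw [Matrix.mul_transvection_apply_same,
          ((hprev (x, l) (.inr ⟨rfl, hlj⟩) hxl).1 hx).1 y hxy]
        ring
      · exact Matrix.mul_transvection_apply_of_ne _ _ _ _ hk _ _

lemma exists_isReducedAt_of_rank_lt {z : Fin n} (hz : ∀ i, z ≤ i) (hz0 : z.val = 0)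
    {A : Mat n F} (hA : PmSupported m A) (N : ℕ) :
    ∃ C, SameOrbit m A C ∧ ∀ p, reductionRank p < N → IsReducedAt m z C p := by
  induction N with
  | zero => exact ⟨A, SameOrbit.refl A, fun p hp => absurd hp (Nat.not_lt_zero _)⟩
  | succ N ih =>
    obtain ⟨C, hAC, hC⟩ := ih
    by_cases hgood : ∀ p, reductionRank p = N → IsReducedAt m z C p
    · exact ⟨C, hAC, fun p hp => (Nat.lt_succ_iff_lt_or_eq.1 hp).elim (hC p) (hgood p)⟩
    push Not at hgood
    obtain ⟨p, hpN, hp⟩ := hgood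
    have hlt : ∀ q, ReductionLT q p → reductionRank q < N := fun q hq =>
      hpN ▸ reductionRank_lt hq
    obtain ⟨D, hCD, hDp, hD⟩ := exists_clear_entry_s7 hz hz0 (hAC.pmSupported hA)
      (fun q hq => hC q (hlt q hq)) hp
    refine ⟨D, hAC.trans hCD, fun q hq => ?_⟩
    rcases reductionLT_trichotomy q p with h | rfl | h
    · refine (hC q (hlt q h)).congr hz fun q' hq' => hD q' ?_
      rcases hq' with hq' | rfl
      · rcases reductionLT_trichotomy q' p with h' | rfl | h'
        · exact h'
        · have := reductionRank_lt hq'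
          have := reductionRank_lt h
          omega
        · have := reductionRank_lt hq'
          have := reductionRank_lt h
          have := reductionRank_lt h'
          omega
      · exact h
    · exact fun h => absurd hDp h
    · have := reductionRank_lt h
      omega

/-- Every two-sided orbit contains a comb matrix. -/
theorem exists_isComb {z : Fin n} (hz : ∀ i, z ≤ i) (hz0 : z.val = 0)
    {A : Mat n F} (hA : PmSupported m A) : ∃ C, SameOrbit m A C ∧ IsComb m z C := by
  obtain ⟨C, hAC, hC'⟩ := exists_isReducedAt_of_rank_lt hz hz0 hA
    ((Finset.univ.sup (reductionRank (n := n))) + 1)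
  have hC : ∀ p, IsReducedAt m z C p := fun p =>
    hC' p (Nat.lt_succ_of_le (Finset.le_sup (f := reductionRank) (Finset.mem_univ p)))
  refine ⟨C, hAC, hAC.pmSupported hA, ?_, ?_, ?_, ?_⟩
  · intro i j j' hi h h'
    rcases lt_trichotomy j j' with hj | hj | hj
    · exact absurd (((hC (i, j') h').1 hi).2 j hj) h
    · exact hj
    · exact absurd (((hC (i, j) h).1 hi).2 j' hj) h'
  · intro i i' j hi hi' h h'
    rcases lt_trichotomy i i' with hj | hj | hj
    · exact absurd (((hC (i, j) h).1 hi).1 i' hj) h'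
    · exact hj
    · exact absurd (((hC (i', j) h').1 hi').1 i hj) h
  · intro i j h hi h'
    by_contra hc
    exact h' (((hC (z, j) h).2 rfl).1 i hi (not_lt.1 hc))
  · intro j k hjk h h'
    exact ((hC (z, k) h').2 rfl).2 j hjk h

end CombExistence

section Link

variable {n m : ℕ} {F : Type*} [Field F]

/-- `j < k` are consecutive elements of the support of `w`. -/
def ConsecSupp (w : Fin n → F) (j k : Fin n) : Prop :=
  j < k ∧ w j ≠ 0 ∧ w k ≠ 0 ∧ ∀ l, j < l → l < k → w l = 0

/-- The unitriangular matrix whose column operations clear all but the first nonzero entry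
of the row vector `w`. -/
noncomputable def linkMatrix (w : Fin n → F) : Mat n F :=
  Matrix.of fun j k => if j = k then 1 else if ConsecSupp w j k then -(w k / w j) else 0

lemma linkMatrix_self (w : Fin n → F) (j : Fin n) : linkMatrix w j j = 1 := by
  simp [linkMatrix]

lemma linkMatrix_of_consecSupp {w : Fin n → F} {j k : Fin n} (h : ConsecSupp w j k) :
    linkMatrix w j k = -(w k / w j) := by
  simp [linkMatrix, h, h.1.ne]

lemma linkMatrix_ne_zero_iff {w : Fin n → F} {j k : Fin n} :
    linkMatrix w j k ≠ 0 ↔ j = k ∨ ConsecSupp w j k := by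
  by_cases hjk : j = k
  · subst hjk
    simp [linkMatrix_self]
  · by_cases h : ConsecSupp w j k
    · simp [linkMatrix_of_consecSupp h, h, h.2.1, h.2.2.1]
    · simp [linkMatrix, h, hjk]

lemma ConsecSupp.left_unique {w : Fin n → F} {j j' k : Fin n} (h : ConsecSupp w j k)
    (h' : ConsecSupp w j' k) : j = j' := by
  rcases lt_trichotomy j j' with hj | hj | hj
  · exact absurd (h.2.2.2 j' hj h'.1) h'.2.1
  · exact hj
  · exact absurd (h'.2.2.2 j hj h.1) h.2.1

lemma linkMatrix_mem_patGroup {z : Fin n} (hz0 : z.val = 0)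
    {w : Fin n → F} (hw : ∀ j, w j ≠ 0 → Pm n m z j) : linkMatrix w ∈ patGroup (Pm n m) := by
  refine ⟨linkMatrix_self w, fun i j hij hP => ?_⟩
  by_contra hc
  have h := (linkMatrix_ne_zero_iff.1 hc).resolve_left hij
  refine hP ⟨h.1, fun hi => ?_⟩
  have : z < i := (hw i h.2.1).1
  have : z.val < i.val := this
  omega

lemma mul_linkMatrix_of_row {C : Mat n F} {w : Fin n → F} {x p : Fin n}
    (h : ∀ l, C x l ≠ 0 → l = p) (j : Fin n) :
    (C * linkMatrix w) x j = C x p * linkMatrix w p j := by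
  rw [Matrix.mul_apply]
  refine Finset.sum_eq_single p (fun l _ hl => ?_) (by simp)
  by_contra hc
  exact hl (h l (left_ne_zero_of_mul hc))

lemma mul_linkMatrix_self_of_consecSupp {C : Mat n F} {z l j : Fin n}
    (h : ConsecSupp (C z) l j) : (C * linkMatrix (C z)) z j = 0 := by
  rw [Matrix.mul_apply, Finset.sum_eq_add l j h.1.ne]
  · rw [linkMatrix_self, linkMatrix_of_consecSupp h]
    have := h.2.1
    field_simp
    ring
  · intro p _ hp
    by_contra hc
    rcases linkMatrix_ne_zero_iff.1 (right_ne_zero_of_mul hc) with h' | h'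
    · exact hp.2 h'
    · exact hp.1 (h'.left_unique h)
  · simp
  · simp

lemma mul_linkMatrix_self_of_not_consecSupp {C : Mat n F} {z j : Fin n}
    (h : ∀ l, ¬ ConsecSupp (C z) l j) : (C * linkMatrix (C z)) z j = C z j := by
  rw [Matrix.mul_apply, Finset.sum_eq_single j]
  · rw [linkMatrix_self, mul_one]
  · intro p _ hp
    by_contra hc
    rcases linkMatrix_ne_zero_iff.1 (right_ne_zero_of_mul hc) with h' | h'
    · exact hp h'
    · exact h p h'
  · simp

/-- `k 1 < ⋯ < k r` enumerates the support of `w`. -/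
structure EnumeratesSupp (w : Fin n → F) (r : ℕ) (k : ℕ → Fin n) : Prop where
  lt_of_lt : ∀ d d', 1 ≤ d → d < d' → d' ≤ r → k d < k d'
  ne_zero_iff : ∀ j, w j ≠ 0 ↔ ∃ d, 1 ≤ d ∧ d ≤ r ∧ j = k d

lemma EnumeratesSupp.inj {w : Fin n → F} {r : ℕ} {k : ℕ → Fin n} (h : EnumeratesSupp w r k)
    {d d' : ℕ} (h1 : 1 ≤ d) (h2 : d ≤ r) (h1' : 1 ≤ d') (h2' : d' ≤ r) (e : k d = k d') :
    d = d' := by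
  rcases lt_trichotomy d d' with hd | hd | hd
  · exact absurd e (h.lt_of_lt _ _ h1 hd h2').ne
  · exact hd
  · exact absurd e (h.lt_of_lt _ _ h1' hd h2).ne'

lemma EnumeratesSupp.lt_iff {w : Fin n → F} {r : ℕ} {k : ℕ → Fin n} (h : EnumeratesSupp w r k)
    {d d' : ℕ} (h1 : 1 ≤ d) (h2 : d ≤ r) (h1' : 1 ≤ d') (h2' : d' ≤ r) :
    k d < k d' ↔ d < d' := by
  refine ⟨fun hk => ?_, fun hd => h.lt_of_lt _ _ h1 hd h2'⟩
  by_contra hc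
  rcases (not_lt.1 hc).lt_or_eq with hd | hd
  · exact lt_asymm hk (h.lt_of_lt _ _ h1' hd h2)
  · exact hk.ne (by rw [hd])

lemma EnumeratesSupp.consecSupp_iff {w : Fin n → F} {r : ℕ} {k : ℕ → Fin n}
    (h : EnumeratesSupp w r k) {j l : Fin n} :
    ConsecSupp w j l ↔ ∃ d, 1 ≤ d ∧ d < r ∧ j = k d ∧ l = k (d + 1) := by
  constructor
  · rintro ⟨hjl, hj, hl, hb⟩
    obtain ⟨d, h1, h2, rfl⟩ := (h.ne_zero_iff j).1 hj
    obtain ⟨d', h1', h2', rfl⟩ := (h.ne_zero_iff l).1 hl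
    have hd := (h.lt_iff h1 h2 h1' h2').1 hjl
    refine ⟨d, h1, by omega, rfl, ?_⟩
    by_contra hc
    have hne : d + 1 ≠ d' := fun e => hc (by rw [e])
    exact (h.ne_zero_iff _).2 ⟨d + 1, by omega, by omega, rfl⟩
      (hb (k (d + 1)) (h.lt_of_lt _ _ h1 (by omega) (by omega))
        (h.lt_of_lt _ _ (by omega) (by omega) h2'))
  · rintro ⟨d, h1, h2, rfl, rfl⟩
    refine ⟨h.lt_of_lt _ _ h1 (by omega) (by omega), (h.ne_zero_iff _).2 ⟨d, h1, by omega, rfl⟩,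
      (h.ne_zero_iff _).2 ⟨d + 1, by omega, by omega, rfl⟩, fun l hl hl' => ?_⟩
    by_contra hc
    obtain ⟨d', h1', h2', rfl⟩ := (h.ne_zero_iff l).1 hc
    have := (h.lt_iff h1 (by omega) h1' h2').1 hl
    have := (h.lt_iff h1' h2' (by omega) (by omega)).1 hl'
    omega

lemma exists_enumeratesSupp {w : Fin n → F} (hw : ∃ j, w j ≠ 0) :
    ∃ r k, 1 ≤ r ∧ EnumeratesSupp w r k := by
  obtain ⟨j0, hj0⟩ := hw
  set s := Finset.univ.filter (fun j => w j ≠ 0) with hs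
  have hmem : ∀ j, j ∈ s ↔ w j ≠ 0 := by simp [hs]
  refine ⟨s.card, fun d => if h : d - 1 < s.card then s.orderEmbOfFin rfl ⟨d - 1, h⟩ else j0,
    Finset.card_pos.2 ⟨j0, (hmem _).2 hj0⟩, ?_, ?_⟩
  · intro d d' h1 h2 h3
    simp only [show d - 1 < s.card by omega, show d' - 1 < s.card by omega, dif_pos]
    rw [OrderEmbedding.lt_iff_lt, Fin.mk_lt_mk]
    omega
  · intro j
    rw [← hmem]
    constructor
    · intro hj
      have : j ∈ Set.range (s.orderEmbOfFin rfl) := by rwa [Finset.range_orderEmbOfFin]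
      obtain ⟨⟨d, hd⟩, rfl⟩ := this
      exact ⟨d + 1, by omega, by omega, by simp [hd]⟩
    · rintro ⟨d, h1, h2, rfl⟩
      simp only [show d - 1 < s.card by omega, dif_pos]
      exact Finset.orderEmbOfFin_mem _ _ _

end Link

section Components

variable {n m : ℕ} {F : Type*} [Field F]

lemma adjRel.symm {A : Mat n F} {p q : Fin n × Fin n} (h : adjRel A p q) : adjRel A q p :=
  ⟨h.1.symm, h.2.2.1, h.2.1, h.2.2.2.imp Eq.symm Eq.symm⟩

lemma reflTransGen_adjRel_symm {A : Mat n F} {p q : Fin n × Fin n}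
    (h : Relation.ReflTransGen (adjRel A) p q) : Relation.ReflTransGen (adjRel A) q p := by
  induction h with
  | refl => exact Relation.ReflTransGen.refl
  | tail _ hbc ih => exact Relation.ReflTransGen.head hbc.symm ih

lemma compOf_eq_of_mem {A : Mat n F} {p q : Fin n × Fin n} (h : q ∈ compOf A p) :
    compOf A q = compOf A p := by
  ext s
  exact ⟨fun hs => Relation.ReflTransGen.trans h hs,
    fun hs => (reflTransGen_adjRel_symm h).trans hs⟩

lemma one_lt_ncard_compOf_iff {A : Mat n F} {p : Fin n × Fin n} :
    1 < (compOf A p).ncard ↔ ∃ q, adjRel A p q := by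
  constructor
  · intro h
    obtain ⟨q, hq, hqp⟩ := Set.exists_ne_of_one_lt_ncard h p
    rcases Relation.ReflTransGen.cases_head hq with h' | ⟨c, hc, -⟩
    · exact absurd h'.symm hqp
    · exact ⟨c, hc⟩
  · rintro ⟨q, hq⟩
    rw [Set.one_lt_ncard (Set.toFinite _)]
    exact ⟨p, Relation.ReflTransGen.refl, q, Relation.ReflTransGen.single hq, hq.1⟩

lemma isPathClassRep_of_component {A : Mat n F} {S : Set (Fin n × Fin n)} {p₀ : Fin n × Fin n}
    (hadj : ∀ p q, adjRel A p q → p ∈ S) (hp₀ : p₀ ∈ S)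
    (hconn : ∀ q ∈ S, Relation.ReflTransGen (adjRel A) p₀ q)
    (hS : PathClassComp m S) : IsPathClassRep m A := by
  have key : ∀ p, 1 < (compOf A p).ncard → compOf A p = S := by
    intro p hp
    obtain ⟨q, hq⟩ := one_lt_ncard_compOf_iff.1 hp
    rw [compOf_eq_of_mem (hconn p (hadj p q hq))]
    ext s
    refine ⟨fun hs => ?_, fun hs => hconn s hs⟩
    rcases Relation.ReflTransGen.cases_tail hs with rfl | ⟨c, -, hc⟩
    · exact hp₀
    · exact hadj s c hc.symm
  exact ⟨fun p q _ _ hp hq => (key p hp).trans (key q hq).symm, fun p _ hp => by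
    rw [key p hp]; exact hS⟩

/-- In a path superclass representative, adjacent positions all lie in a common component. -/
lemma IsPathClassRep.exists_component {A : Mat n F} (h : IsPathClassRep m A)
    (hadj : ∃ p q, adjRel A p q) :
    ∃ S, PathClassComp m S ∧ (∀ p ∈ S, A p.1 p.2 ≠ 0) ∧ ∀ p q, adjRel A p q → p ∈ S := by
  obtain ⟨p, q, hpq⟩ := hadj
  have hp := one_lt_ncard_compOf_iff.2 ⟨q, hpq⟩
  refine ⟨compOf A p, h.2 p hpq.2.1 hp, fun s hs => ?_, fun p' q' h' => ?_⟩
  · rcases Relation.ReflTransGen.cases_tail hs with rfl | ⟨c, -, hc⟩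
    · exact hpq.2.1
    · exact hc.2.2.1
  · rw [← h.1 p' p h'.2.1 hpq.2.1 (one_lt_ncard_compOf_iff.2 ⟨q', h'⟩) hp]
    exact Relation.ReflTransGen.refl

lemma isPathClassRep_of_not_adjRel {A : Mat n F} (h : ∀ p q, ¬ adjRel A p q) :
    IsPathClassRep m A :=
  ⟨fun p _ _ _ hp _ => ((one_lt_ncard_compOf_iff.1 hp).elim fun q hq => (h p q hq).elim),
    fun p _ hp => ((one_lt_ncard_compOf_iff.1 hp).elim fun q hq => (h p q hq).elim)⟩

end Components

section PathShape

variable {n m : ℕ} {F : Type*} [Field F]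

/-- Rows `ι d` (for `1 ≤ d ≤ r'`) and columns `κ d` (for `1 ≤ d ≤ r`) along which a path
component runs. -/
structure PathData (m : ℕ) (z : Fin n) (r r' : ℕ) (ι κ : ℕ → Fin n) : Prop where
  one_le : 1 ≤ r
  length : r' = r ∨ r' + 1 = r
  col_lt : ∀ d d', 1 ≤ d → d < d' → d' ≤ r → κ d < κ d'
  row_lt : ∀ d d', 1 ≤ d → d < d' → d' ≤ r' → ι d' < ι d
  row_ne : ∀ d, 1 ≤ d → d ≤ r' → ι d ≠ z
  row_small : ∀ d, 1 ≤ d → d ≤ r' → (ι d).val < m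
  le_col : m ≤ (κ 1).val

/-- The positions of a path component. -/
def pathSet (z : Fin n) (r r' : ℕ) (ι κ : ℕ → Fin n) : Set (Fin n × Fin n) :=
  {v | (v.1 = z ∧ v.2 = κ 1) ∨ (∃ d, 1 ≤ d ∧ d ≤ r' ∧ v.1 = ι d ∧ v.2 = κ d) ∨
    ∃ d, 1 ≤ d ∧ d < r ∧ v.1 = ι d ∧ v.2 = κ (d + 1)}

lemma PathData.row_inj {z : Fin n} {r r' : ℕ} {ι κ : ℕ → Fin n} (h : PathData m z r r' ι κ)
    {d d' : ℕ} (h1 : 1 ≤ d) (h2 : d ≤ r') (h1' : 1 ≤ d') (h2' : d' ≤ r') (e : ι d = ι d') :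
    d = d' := by
  rcases lt_trichotomy d d' with hd | hd | hd
  · exact absurd e (h.row_lt _ _ h1 hd h2').ne'
  · exact hd
  · exact absurd e (h.row_lt _ _ h1' hd h2).ne

lemma PathData.col_inj {z : Fin n} {r r' : ℕ} {ι κ : ℕ → Fin n} (h : PathData m z r r' ι κ)
    {d d' : ℕ} (h1 : 1 ≤ d) (h2 : d ≤ r) (h1' : 1 ≤ d') (h2' : d' ≤ r) (e : κ d = κ d') :
    d = d' := by
  rcases lt_trichotomy d d' with hd | hd | hd
  · exact absurd e (h.col_lt _ _ h1 hd h2').ne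
  · exact hd
  · exact absurd e (h.col_lt _ _ h1' hd h2).ne'

lemma lt_of_succ_lt_of_lt {f : ℕ → ℕ} {R : ℕ} (h : ∀ d, 1 ≤ d → d < R → f d < f (d + 1))
    (d d' : ℕ) (h1 : 1 ≤ d) (h2 : d < d') (h3 : d' ≤ R) : f d < f d' := by
  induction d', h2 using Nat.le_induction with
  | base => exact h d h1 h3
  | succ k hk ih => exact (ih (by omega)).trans (h k (by omega) (by omega))

lemma gt_of_succ_gt_of_lt {f : ℕ → ℕ} {R : ℕ} (h : ∀ d, 1 ≤ d → d < R → f (d + 1) < f d)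
    (d d' : ℕ) (h1 : 1 ≤ d) (h2 : d < d') (h3 : d' ≤ R) : f d' < f d := by
  induction d', h2 using Nat.le_induction with
  | base => exact h d h1 h3
  | succ k hk ih => exact (h k (by omega) (by omega)).trans (ih (by omega))

lemma PathData.pathClassComp (hm : 0 < m) {z : Fin n} (hz0 : z.val = 0) {r r' : ℕ}
    {ι κ : ℕ → Fin n} (h : PathData m z r r' ι κ) : PathClassComp m (pathSet z r r' ι κ) := by
  have hr := h.one_le
  have hlen := h.length
  obtain ⟨e, he⟩ : ∃ e : Bool, r' = if e then r else r - 1 := by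
    rcases hlen with h' | h'
    · exact ⟨true, by simp [h']⟩
    · exact ⟨false, by simp [← h']⟩
  have hpos : ∀ d, 1 ≤ d → d ≤ r' → 0 < (ι d).val := fun d h1 h2 => by
    have h3 := h.row_ne d h1 h2
    by_contra hc
    exact h3 (Fin.ext (by omega))
  refine ⟨r, e, fun d => if 1 ≤ d ∧ d ≤ r' then (ι d).val + 1 else if d = 0 then 2 else 1,
    fun d => (κ d).val + 1, hr, ?_, ?_, ?_, ?_, ?_, ?_, ?_⟩
  · rw [← he]
    intro d h1 h2
    beta_reduce
    rw [if_pos ⟨by omega, by omega⟩, if_pos ⟨by omega, by omega⟩]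
    have : (ι (d + 1)).val < (ι d).val := h.row_lt d (d + 1) h1 (by omega) (by omega)
    omega
  · rw [← he]
    by_cases h0 : r' = 0
    · simp [h0]
    · have := hpos r' (by omega) le_rfl
      simp only [show 1 ≤ r' ∧ r' ≤ r' from ⟨by omega, le_rfl⟩, if_true, and_self]
      omega
  · by_cases h0 : r' = 0
    · simp only [h0]
      simpa using Nat.succ_le_of_lt hm
    · simp only [show 1 ≤ 1 ∧ 1 ≤ r' from ⟨le_rfl, by omega⟩, if_true, and_self]
      exact h.row_small 1 le_rfl (by omega)
  · exact Nat.lt_succ_of_le h.le_col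
  · intro d h1 h2
    exact Nat.succ_lt_succ (h.col_lt d (d + 1) h1 (by omega) (by omega))
  · exact (κ r).2
  · have hi : ∀ d, 1 ≤ d → d ≤ r' →
        (if 1 ≤ d ∧ d ≤ r' then (ι d).val + 1 else if d = 0 then 2 else 1) = (ι d).val + 1 :=
      fun d h1 h2 => if_pos ⟨h1, h2⟩
    ext ⟨x, y⟩
    simp only [pathSet, Set.mem_ofPred_eq]
    constructor
    · rintro (⟨rfl, rfl⟩ | ⟨d, h1, h2, rfl, rfl⟩ | ⟨d, h1, h2, rfl, rfl⟩)
      · exact .inl ⟨by omega, rfl⟩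
      · by_cases hd : d ≤ r - 1
        · exact .inr (.inl ⟨d, h1, hd, (hi d h1 h2).symm, rfl⟩)
        · have hdr : d = r := by omega
          subst hdr
          refine .inr (.inr (.inr ⟨?_, (hi d h1 h2).symm, rfl⟩))
          by_contra hc
          rw [if_neg hc] at he
          omega
      · exact .inr (.inr (.inl ⟨d, h1, by omega, (hi d h1 (by omega)).symm, rfl⟩))
    · rintro (⟨hx, hy⟩ | ⟨d, h1, h2, hx, hy⟩ | ⟨d, h1, h2, hx, hy⟩ | ⟨rfl, hx, hy⟩)
      · exact .inl ⟨Fin.ext (by omega), Fin.ext (by omega)⟩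
      · rw [hi d h1 (by omega)] at hx
        exact .inr (.inl ⟨d, h1, by omega, Fin.ext (by omega), Fin.ext (by omega)⟩)
      · rw [hi d h1 (by omega)] at hx
        exact .inr (.inr ⟨d, h1, by omega, Fin.ext (by omega), Fin.ext (by omega)⟩)
      · rw [if_pos rfl] at he
        rw [hi r hr (by omega)] at hx
        exact .inr (.inl ⟨r, hr, by omega, Fin.ext (by omega), Fin.ext (by omega)⟩)

lemma PathClassComp.exists_pathData (hmn : m < n) {z : Fin n} (hz0 : z.val = 0)
    {S : Set (Fin n × Fin n)} (h : PathClassComp m S) :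
    ∃ r r' ι κ, PathData m z r r' ι κ ∧ S = pathSet z r r' ι κ := by
  obtain ⟨r, e, i, k, hr, hi, hi1, him, hmk, hk, hkn, rfl⟩ := h
  generalize he : (if e then r else r - 1) = r' at hi hi1
  have hlen : r' = r ∨ r' + 1 = r := by
    cases e <;> simp at he <;> omega
  have hilt := gt_of_succ_gt_of_lt hi
  have hklt := lt_of_succ_lt_of_lt hk
  have hile : ∀ d, 1 ≤ d → d ≤ r' → 1 < i d ∧ i d ≤ m := by
    intro d h1 h2
    constructor
    · rcases h2.eq_or_lt with rfl | h2
      · exact hi1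
      · exact hi1.trans (hilt d r' h1 h2 le_rfl)
    · rcases h1.eq_or_lt with rfl | h1
      · exact him
      · exact (hilt 1 d le_rfl h1 h2).le.trans him
  have hkle : ∀ d, 1 ≤ d → d ≤ r → m < k d ∧ k d ≤ n := by
    intro d h1 h2
    constructor
    · rcases h1.eq_or_lt with rfl | h1
      · exact hmk
      · exact hmk.trans (hklt 1 d le_rfl h1 h2)
    · rcases h2.eq_or_lt with rfl | h2
      · exact hkn
      · exact (hklt d r h1 h2 le_rfl).le.trans hkn
  have hι : ∀ d, ∃ x : Fin n, 1 ≤ d → d ≤ r' → x.val + 1 = i d := fun d => by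
    by_cases hd : 1 ≤ d ∧ d ≤ r'
    · have := hile d hd.1 hd.2
      exact ⟨⟨i d - 1, by omega⟩, fun _ _ => Nat.sub_add_cancel (by omega)⟩
    · exact ⟨z, fun h1 h2 => absurd ⟨h1, h2⟩ hd⟩
  have hκ : ∀ d, ∃ x : Fin n, 1 ≤ d → d ≤ r → x.val + 1 = k d := fun d => by
    by_cases hd : 1 ≤ d ∧ d ≤ r
    · have := hkle d hd.1 hd.2
      exact ⟨⟨k d - 1, by omega⟩, fun _ _ => Nat.sub_add_cancel (by omega)⟩
    · exact ⟨z, fun h1 h2 => absurd ⟨h1, h2⟩ hd⟩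
  choose ι hι using hι
  choose κ hκ using hκ
  refine ⟨r, r', ι, κ, ⟨hr, hlen, ?_, ?_, ?_, ?_, ?_⟩, ?_⟩
  · intro d d' h1 h2 h3
    rw [Fin.lt_def]
    have := hklt d d' h1 h2 h3
    have := hκ d h1 (by omega)
    have := hκ d' (by omega) h3
    omega
  · intro d d' h1 h2 h3
    rw [Fin.lt_def]
    have := hilt d d' h1 h2 h3
    have := hι d h1 (by omega)
    have := hι d' (by omega) h3
    omega
  · rintro d h1 h2 hd
    have := hile d h1 h2
    have := hι d h1 h2
    rw [hd] at this
    omega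
  · intro d h1 h2
    have := hile d h1 h2
    have := hι d h1 h2
    omega
  · have := hκ 1 le_rfl hr
    omega
  · ext ⟨x, y⟩
    simp only [pathSet, Set.mem_ofPred_eq]
    constructor
    · rintro (⟨hx, hy⟩ | ⟨d, h1, h2, hx, hy⟩ | ⟨d, h1, h2, hx, hy⟩ | ⟨rfl, hx, hy⟩)
      · have := hκ 1 le_rfl hr
        exact .inl ⟨Fin.ext (by omega), Fin.ext (by omega)⟩
      · have := hκ d h1 (by omega)
        have := hι d h1 (by omega)
        exact .inr (.inl ⟨d, h1, by omega, Fin.ext (by omega), Fin.ext (by omega)⟩)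
      · have := hκ (d + 1) (by omega) (by omega)
        have := hι d h1 (by omega)
        exact .inr (.inr ⟨d, h1, by omega, Fin.ext (by omega), Fin.ext (by omega)⟩)
      · rw [if_pos rfl] at he
        have := hκ r hr le_rfl
        have := hι r hr (by omega)
        exact .inr (.inl ⟨r, hr, by omega, Fin.ext (by omega), Fin.ext (by omega)⟩)
    · rintro (⟨rfl, rfl⟩ | ⟨d, h1, h2, rfl, rfl⟩ | ⟨d, h1, h2, rfl, rfl⟩)
      · exact .inl ⟨by omega, hκ 1 le_rfl hr⟩
      · by_cases hd : d ≤ r - 1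
        · exact .inr (.inl ⟨d, h1, hd, hι d h1 h2, hκ d h1 (by omega)⟩)
        · have hdr : d = r := by omega
          subst hdr
          refine .inr (.inr (.inr ⟨?_, hι d h1 h2, hκ d h1 le_rfl⟩))
          by_contra hc
          rw [if_neg hc] at he
          omega
      · exact .inr (.inr (.inl ⟨d, h1, by omega, hι d h1 (by omega),
          hκ (d + 1) (by omega) (by omega)⟩))

end PathShape

section CombToPath

variable {n m : ℕ} {F : Type*} [Field F]

lemma IsComb.mul_linkMatrix_ne_zero_iff {z : Fin n} {C : Mat n F} (hC : IsComb m z C)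
    {w : Fin n → F} {x j : Fin n} (hx : x ≠ z) :
    (C * linkMatrix w) x j ≠ 0 ↔ ∃ p, C x p ≠ 0 ∧ (p = j ∨ ConsecSupp w p j) := by
  by_cases h : ∃ p, C x p ≠ 0
  · obtain ⟨p, hp⟩ := h
    rw [mul_linkMatrix_of_row (fun l hl => hC.row x l p hx hl hp), mul_ne_zero_iff,
      linkMatrix_ne_zero_iff]
    refine ⟨fun h => ⟨p, h⟩, ?_⟩
    rintro ⟨p', hp', h⟩
    rw [hC.row x p p' hx hp hp']
    exact ⟨hp', h⟩
  · push Not at h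
    rw [mul_linkMatrix_of_row (p := j) (fun l hl => absurd (h l) hl), h j, zero_mul]
    exact ⟨fun h' => absurd rfl h', fun ⟨p, hp, _⟩ => absurd (h p) hp⟩

/-- Clearing the first row of a comb matrix by column operations yields a path representative. -/
theorem IsComb.isPathClassRep (hm : 0 < m) {z : Fin n} (hz0 : z.val = 0) {C : Mat n F}
    (hC : IsComb m z C) : IsPathClassRep m (C * linkMatrix (C z)) := by
  by_cases hw : ∃ j, C z j ≠ 0
  swap
  · push Not at hw
    have hz : ∀ j, (C * linkMatrix (C z)) z j = 0 := fun j => by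
      rw [mul_linkMatrix_self_of_not_consecSupp (fun l h => h.2.1 (hw l)), hw]
    have hne : ∀ x j, (C * linkMatrix (C z)) x j ≠ 0 → x ≠ z ∧ C x j ≠ 0 := by
      intro x j h
      have hx : x ≠ z := by
        rintro rfl
        exact h (hz j)
      obtain ⟨p, hp, rfl | h'⟩ := (hC.mul_linkMatrix_ne_zero_iff hx).1 h
      · exact ⟨hx, hp⟩
      · exact absurd (hw p) h'.2.1
    refine isPathClassRep_of_not_adjRel ?_
    rintro ⟨x, j⟩ ⟨y, l⟩ ⟨h1, h2, h3, h4⟩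
    obtain ⟨hx, hx'⟩ := hne _ _ h2
    obtain ⟨hy, hy'⟩ := hne _ _ h3
    simp only at h4 hx hx' hy hy'
    rcases h4 with rfl | rfl
    · exact h1 (by rw [hC.row _ _ _ hx hx' hy'])
    · exact h1 (by rw [hC.col _ _ _ hx hy hx' hy'])
  obtain ⟨r, κ, hr, hκ⟩ := exists_enumeratesSupp hw
  have hwκ : ∀ d, 1 ≤ d → d ≤ r → C z (κ d) ≠ 0 := fun d h1 h2 =>
    (hκ.ne_zero_iff _).2 ⟨d, h1, h2, rfl⟩
  have hι : ∀ d, ∃ x : Fin n, (∃ y, y ≠ z ∧ C y (κ d) ≠ 0) → x ≠ z ∧ C x (κ d) ≠ 0 := by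
    intro d
    by_cases h : ∃ y, y ≠ z ∧ C y (κ d) ≠ 0
    · exact ⟨h.choose, fun _ => h.choose_spec⟩
    · exact ⟨z, fun h' => absurd h' h⟩
  choose ι hι using hι
  have hιlt : ∀ d, 1 ≤ d → d < r → ι d ≠ z ∧ C (ι d) (κ d) ≠ 0 := by
    intro d h1 h2
    obtain ⟨i, hi, hi', -⟩ := hC.anti (κ d) (κ r) (hκ.lt_of_lt _ _ h1 h2 le_rfl)
      (hwκ d h1 h2.le) (hwκ r hr le_rfl)
    exact hι d ⟨i, hi, hi'⟩
  obtain ⟨r', hlen, hr'⟩ : ∃ r', (r' = r ∨ r' + 1 = r) ∧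
      ∀ d, 1 ≤ d → d ≤ r → (d ≤ r' ↔ ∃ y, y ≠ z ∧ C y (κ d) ≠ 0) := by
    by_cases h : ∃ y, y ≠ z ∧ C y (κ r) ≠ 0
    · refine ⟨r, .inl rfl, fun d h1 h2 => ⟨fun _ => ?_, fun _ => h2⟩⟩
      rcases h2.eq_or_lt with rfl | h2
      · exact h
      · exact ⟨_, hιlt d h1 h2⟩
    · refine ⟨r - 1, .inr (by omega), fun d h1 h2 => ⟨fun h3 => ⟨_, hιlt d h1 (by omega)⟩,
        fun h3 => ?_⟩⟩
      by_contra hc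
      have : d = r := by omega
      exact h (this ▸ h3)
  have hιr : ∀ d, 1 ≤ d → d ≤ r' → ι d ≠ z ∧ C (ι d) (κ d) ≠ 0 := fun d h1 h2 =>
    hι d ((hr' d h1 (by omega)).1 h2)
  have huniq : ∀ d x, 1 ≤ d → d ≤ r → x ≠ z → C x (κ d) ≠ 0 → d ≤ r' ∧ x = ι d := by
    intro d x h1 h2 hx h
    have h3 := (hr' d h1 h2).2 ⟨x, hx, h⟩
    exact ⟨h3, hC.col _ _ _ hx (hιr d h1 h3).1 h (hιr d h1 h3).2⟩
  have hdata : PathData m z r r' ι κ := by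
    refine ⟨hr, hlen, hκ.lt_of_lt, ?_, fun d h1 h2 => (hιr d h1 h2).1, ?_, ?_⟩
    · intro d d' h1 h2 h3
      obtain ⟨i, hi, hi', h⟩ := hC.anti (κ d) (κ d') (hκ.lt_of_lt _ _ h1 h2 (by omega))
        (hwκ d h1 (by omega)) (hwκ d' (by omega) (by omega))
      rw [← (huniq d i h1 (by omega) hi hi').2]
      exact h _ (hιr d' (by omega) h3).1 (hιr d' (by omega) h3).2
    · intro d h1 h2
      exact hC.low _ _ (hwκ d h1 (by omega)) (hιr d h1 h2).1 (hιr d h1 h2).2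
    · exact Nat.le_of_lt_succ ((hC.supp _ _ (hwκ 1 le_rfl hr)).2 hz0)
  have hAz : ∀ j, (C * linkMatrix (C z)) z j ≠ 0 ↔ j = κ 1 := by
    intro j
    by_cases h : ∃ l, ConsecSupp (C z) l j
    · obtain ⟨l, hl⟩ := h
      rw [mul_linkMatrix_self_of_consecSupp hl]
      refine ⟨fun h => absurd rfl h, ?_⟩
      rintro rfl
      obtain ⟨d, h1, h2, -, h3⟩ := hκ.consecSupp_iff.1 hl
      have := hκ.inj le_rfl hr (by omega) (by omega) h3
      omega
    · push Not at h
      rw [mul_linkMatrix_self_of_not_consecSupp h]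
      constructor
      · intro hj
        obtain ⟨d, h1, h2, rfl⟩ := (hκ.ne_zero_iff j).1 hj
        by_contra hc
        have hd : d ≠ 1 := fun hd => hc (by rw [hd])
        exact h (κ (d - 1)) (hκ.consecSupp_iff.2
          ⟨d - 1, by omega, by omega, rfl, by rw [Nat.sub_add_cancel h1]⟩)
      · rintro rfl
        exact hwκ 1 le_rfl hr
  have hAx : ∀ x j, x ≠ z → ((C * linkMatrix (C z)) x j ≠ 0 ↔
      C x j ≠ 0 ∨ ∃ d, 1 ≤ d ∧ d < r ∧ x = ι d ∧ j = κ (d + 1)) := by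
    intro x j hx
    rw [hC.mul_linkMatrix_ne_zero_iff hx]
    constructor
    · rintro ⟨p, hp, rfl | h⟩
      · exact .inl hp
      · obtain ⟨d, h1, h2, rfl, rfl⟩ := hκ.consecSupp_iff.1 h
        exact .inr ⟨d, h1, h2, (huniq d x h1 h2.le hx hp).2, rfl⟩
    · rintro (h | ⟨d, h1, h2, rfl, rfl⟩)
      · exact ⟨j, h, .inl rfl⟩
      · exact ⟨κ d, (hιlt d h1 h2).2, .inr (hκ.consecSupp_iff.2 ⟨d, h1, h2, rfl, rfl⟩)⟩
  generalize C * linkMatrix (C z) = A at hAz hAx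
  have hA0 : A z (κ 1) ≠ 0 := (hAz _).2 rfl
  have hA1 : ∀ d, 1 ≤ d → d ≤ r' → A (ι d) (κ d) ≠ 0 := fun d h1 h2 =>
    (hAx _ _ (hιr d h1 h2).1).2 (.inl (hιr d h1 h2).2)
  have hA2 : ∀ d, 1 ≤ d → d < r → A (ι d) (κ (d + 1)) ≠ 0 := fun d h1 h2 =>
    (hAx _ _ (hιlt d h1 h2).1).2 (.inr ⟨d, h1, h2, rfl, rfl⟩)
  refine isPathClassRep_of_component (S := pathSet z r r' ι κ) (p₀ := (z, κ 1)) ?_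
    (.inl ⟨rfl, rfl⟩) ?_ (hdata.pathClassComp hm hz0)
  · rintro ⟨x, j⟩ ⟨y, l⟩ ⟨h1, h2, h3, h4⟩
    simp only at h2 h3 h4
    by_cases hx : x = z
    · subst hx
      exact .inl ⟨rfl, (hAz j).1 h2⟩
    rcases (hAx x j hx).1 h2 with hxj | h
    swap
    · exact .inr (.inr h)
    refine .inr (.inl ?_)
    suffices h : ∃ d, 1 ≤ d ∧ d ≤ r ∧ C x (κ d) ≠ 0 by
      obtain ⟨d, h1, h2, hd⟩ := h
      exact ⟨d, h1, (huniq d x h1 h2 hx hd).1, (huniq d x h1 h2 hx hd).2,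
        hC.row _ _ _ hx hxj hd⟩
    rcases h4 with rfl | rfl
    · rcases (hAx x l hx).1 h3 with hxl | ⟨d, h5, h6, rfl, rfl⟩
      · exact absurd (by rw [hC.row _ _ _ hx hxj hxl]) h1
      · exact ⟨d, h5, h6.le, (hιlt d h5 h6).2⟩
    · by_cases hy : y = z
      · subst hy
        have := (hAz j).1 h3
        subst this
        exact ⟨1, le_rfl, hr, hxj⟩
      · rcases (hAx y j hy).1 h3 with hyj | ⟨d, h5, h6, rfl, rfl⟩
        · exact absurd (by rw [hC.col _ _ _ hx hy hxj hyj]) h1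
        · exact ⟨d + 1, by omega, by omega, hxj⟩
  · have hdown : ∀ d, 1 ≤ d → d ≤ r' →
        Relation.ReflTransGen (adjRel A) (z, κ 1) (ι d, κ d) := by
      intro d hd
      induction d, hd using Nat.le_induction with
      | base =>
        intro h
        refine Relation.ReflTransGen.single ⟨?_, hA0, hA1 1 le_rfl h, .inr rfl⟩
        intro he
        exact (hιr 1 le_rfl h).1 (Prod.ext_iff.1 he).1.symm
      | succ d hd ih =>
        intro h
        refine ((ih (by omega)).tail (b := (ι d, κ d)) (c := (ι d, κ (d + 1)))
          ⟨?_, hA1 d hd (by omega), hA2 d hd (by omega), .inl rfl⟩).tail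
          ⟨?_, hA2 d hd (by omega), hA1 (d + 1) (by omega) h, .inr rfl⟩
        · intro he
          exact (hκ.lt_of_lt d (d + 1) hd (by omega) (by omega)).ne (Prod.ext_iff.1 he).2
        · intro he
          exact (hdata.row_lt d (d + 1) hd (by omega) h).ne' (Prod.ext_iff.1 he).1
    rintro ⟨x, j⟩ (⟨hx, hj⟩ | ⟨d, h1, h2, hx, hj⟩ | ⟨d, h1, h2, hx, hj⟩) <;>
      simp only at hx hj <;> subst hx <;> subst hj
    · exact Relation.ReflTransGen.refl
    · exact hdown d h1 h2
    · refine (hdown d h1 (by omega)).tail ⟨?_, hA1 d h1 (by omega), hA2 d h1 h2, .inl rfl⟩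
      intro he
      exact (hκ.lt_of_lt d (d + 1) h1 (by omega) (by omega)).ne (Prod.ext_iff.1 he).2

end CombToPath

section PathToComb

variable {n m : ℕ} {F : Type*} [Field F]

lemma exists_eq_mul_linkMatrix_of_not_adjRel {z : Fin n} {A : Mat n F} (hA : PmSupported m A)
    (h : ∀ p q, ¬ adjRel A p q) : ∃ C, IsComb m z C ∧ A = C * linkMatrix (C z) := by
  have hrow : ∀ i j j', A i j ≠ 0 → A i j' ≠ 0 → j = j' := by
    intro i j j' h1 h2
    by_contra hc
    exact h (i, j) (i, j') ⟨fun he => hc (Prod.ext_iff.1 he).2, h1, h2, .inl rfl⟩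
  have hcol : ∀ i i' j, A i j ≠ 0 → A i' j ≠ 0 → i = i' := by
    intro i i' j h1 h2
    by_contra hc
    exact h (i, j) (i', j) ⟨fun he => hc (Prod.ext_iff.1 he).1, h1, h2, .inr rfl⟩
  refine ⟨A, ⟨hA, fun i j j' _ => hrow i j j', fun i i' j _ _ => hcol i i' j,
    fun i j h1 h2 h3 => absurd (hcol _ _ _ h3 h1) h2,
    fun j k hjk h1 h2 => absurd (hrow _ _ _ h1 h2) hjk.ne⟩, ?_⟩
  have hcs : ∀ j k, ¬ ConsecSupp (A z) j k := fun j k h => h.1.ne (hrow _ _ _ h.2.1 h.2.2.1)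
  have hone : linkMatrix (A z) = 1 := by
    ext j k
    by_cases hjk : j = k
    · subst hjk
      rw [linkMatrix_self, Matrix.one_apply_eq]
    · rw [Matrix.one_apply_ne hjk]
      by_contra hc
      exact hcs _ _ ((linkMatrix_ne_zero_iff.1 hc).resolve_left hjk)
  rw [hone, Matrix.mul_one]

/-- Every path representative arises from a comb matrix by clearing its first row. -/
theorem IsPathClassRep.exists_eq_mul_linkMatrix (hm : 0 < m) (hmn : m < n) {z : Fin n}
    (hz0 : z.val = 0) {A : Mat n F} (hA : PmSupported m A) (h : IsPathClassRep m A) :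
    ∃ C, IsComb m z C ∧ A = C * linkMatrix (C z) := by
  by_cases hadj : ∃ p q, adjRel A p q
  swap
  · push Not at hadj
    exact exists_eq_mul_linkMatrix_of_not_adjRel hA hadj
  obtain ⟨S, hS, hS0, hSadj⟩ := h.exists_component hadj
  obtain ⟨r, r', ι, κ, hd, rfl⟩ := hS.exists_pathData hmn hz0
  have hr := hd.one_le
  have hlen := hd.length
  have hA0 : A z (κ 1) ≠ 0 := hS0 (z, κ 1) (.inl ⟨rfl, rfl⟩)
  have hA1 : ∀ d, 1 ≤ d → d ≤ r' → A (ι d) (κ d) ≠ 0 := fun d h1 h2 =>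
    hS0 (ι d, κ d) (.inr (.inl ⟨d, h1, h2, rfl, rfl⟩))
  have hA2 : ∀ d, 1 ≤ d → d < r → A (ι d) (κ (d + 1)) ≠ 0 := fun d h1 h2 =>
    hS0 (ι d, κ (d + 1)) (.inr (.inr ⟨d, h1, h2, rfl, rfl⟩))
  let link : Fin n → Fin n → Prop := fun x j => ∃ d, 1 ≤ d ∧ d < r ∧ x = ι d ∧ j = κ (d + 1)
  have hmem : ∀ x j y l, (x ≠ y ∨ j ≠ l) → A x j ≠ 0 → A y l ≠ 0 → (x = y ∨ j = l) → x ≠ z →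
      ¬ link x j → ∃ d, 1 ≤ d ∧ d ≤ r' ∧ x = ι d ∧ j = κ d := by
    intro x j y l hne h1 h2 h3 hx hl
    have hp : ((x, j) : Fin n × Fin n) ∈ pathSet z r r' ι κ := by
      refine hSadj (x, j) (y, l) ⟨fun he => ?_, h1, h2, h3⟩
      exact hne.elim (fun h => h (Prod.ext_iff.1 he).1) (fun h => h (Prod.ext_iff.1 he).2)
    rcases hp with ⟨hxz, -⟩ | hp | hp
    · exact absurd hxz hx
    · exact hp
    · exact absurd hp hl
  have hkey : ∀ d x, 1 ≤ d → d ≤ r → x ≠ z → A x (κ d) ≠ 0 → ¬ link x (κ d) →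
      d ≤ r' ∧ x = ι d := by
    intro d x h1 h2 hx hxd hl
    obtain ⟨y, hy, hyd⟩ : ∃ y, x ≠ y ∧ A y (κ d) ≠ 0 := by
      rcases h1.eq_or_lt with rfl | h1
      · exact ⟨z, hx, hA0⟩
      · obtain ⟨d, rfl⟩ := Nat.exists_eq_add_of_lt h1
        rw [add_comm 1 d] at *
        refine ⟨ι (d + 1), ?_, hA2 _ (by omega) (by omega)⟩
        rintro rfl
        exact hl ⟨d + 1, by omega, by omega, rfl, rfl⟩
    obtain ⟨d', h1', h2', rfl, e⟩ := hmem x (κ d) y (κ d) (.inl hy) hxd hyd (.inr rfl) hx hl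
    have := hd.col_inj h1 h2 h1' (by omega) e
    subst this
    exact ⟨h2', rfl⟩
  have hAz : ∀ j, A z j ≠ 0 → j = κ 1 := by
    intro j hj
    by_contra hc
    have hp : ((z, j) : Fin n × Fin n) ∈ pathSet z r r' ι κ :=
      hSadj (z, j) (z, κ 1) ⟨fun he => hc (Prod.ext_iff.1 he).2, hj, hA0, .inl rfl⟩
    rcases hp with ⟨-, hj'⟩ | ⟨d, h1, h2, h3, -⟩ | ⟨d, h1, h2, h3, -⟩
    · exact hc hj'
    · exact hd.row_ne d h1 h2 h3.symm
    · exact hd.row_ne d h1 (by omega) h3.symm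
  have hdiag : ∀ d, 1 ≤ d → d ≤ r' → ¬ link (ι d) (κ d) := by
    rintro d h1 h2 ⟨d', h3, h4, h5, h6⟩
    have := hd.row_inj h1 h2 h3 (by omega) h5
    have := hd.col_inj h1 (by omega) (by omega) (by omega) h6
    omega
  obtain ⟨W, hW1, hWs⟩ : ∃ W : ℕ → F, W 1 = A z (κ 1) ∧
      ∀ d, 1 ≤ d → W (d + 1) = -(W d * A (ι d) (κ (d + 1)) / A (ι d) (κ d)) := by
    refine ⟨fun d => Nat.rec (motive := fun _ => F) 0 (fun d W => if d = 0 then A z (κ 1) else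
      -(W * A (ι d) (κ (d + 1)) / A (ι d) (κ d))) d, rfl, fun d h1 => ?_⟩
    exact if_neg (by omega)
  have hW : ∀ d, 1 ≤ d → d ≤ r → W d ≠ 0 := by
    intro d h1
    induction d, h1 using Nat.le_induction with
    | base => exact fun _ => hW1 ▸ hA0
    | succ d h1 ih =>
      intro h2
      rw [hWs d h1]
      exact neg_ne_zero.2 (div_ne_zero (mul_ne_zero (ih (by omega)) (hA2 d h1 (by omega)))
        (hA1 d h1 (by omega)))
  obtain ⟨w, hwκ, hw⟩ : ∃ w : Fin n → F, (∀ d, 1 ≤ d → d ≤ r → w (κ d) = W d) ∧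
      ∀ j, w j ≠ 0 → ∃ d, 1 ≤ d ∧ d ≤ r ∧ j = κ d := by
    have : ∀ j, ∃ c : F, (∀ d, 1 ≤ d → d ≤ r → j = κ d → c = W d) ∧
        (c ≠ 0 → ∃ d, 1 ≤ d ∧ d ≤ r ∧ j = κ d) := by
      intro j
      by_cases hj : ∃ d, 1 ≤ d ∧ d ≤ r ∧ j = κ d
      · obtain ⟨d, h1, h2, rfl⟩ := hj
        refine ⟨W d, fun d' h1' h2' e => ?_, fun _ => ⟨d, h1, h2, rfl⟩⟩
        rw [hd.col_inj h1 h2 h1' h2' e]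
      · exact ⟨0, fun d h1 h2 e => absurd ⟨d, h1, h2, e⟩ hj, fun hc => absurd rfl hc⟩
    choose w hw using this
    exact ⟨w, fun d h1 h2 => (hw _).1 d h1 h2 rfl, fun j => (hw j).2⟩
  have hE : EnumeratesSupp w r κ := by
    refine ⟨hd.col_lt, fun j => ⟨hw j, ?_⟩⟩
    rintro ⟨d, h1, h2, rfl⟩
    exact (hwκ d h1 h2).symm ▸ hW d h1 h2
  let C : Mat n F := Matrix.of fun x j => if x = z then w j else if link x j then 0 else A x j
  have hCz : C z = w := by
    funext j
    simp [C]
  have hCl : ∀ x j, x ≠ z → link x j → C x j = 0 := fun x j hx hl => by simp [C, hx, hl]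
  have hCA : ∀ x j, x ≠ z → ¬ link x j → C x j = A x j := fun x j hx hl => by simp [C, hx, hl]
  have hC0 : ∀ x j, x ≠ z → C x j ≠ 0 → A x j ≠ 0 ∧ ¬ link x j := by
    intro x j hx hc
    have hl : ¬ link x j := fun hl => hc (hCl x j hx hl)
    exact ⟨hCA x j hx hl ▸ hc, hl⟩
  have hCι : ∀ d, 1 ≤ d → d ≤ r' → C (ι d) (κ d) = A (ι d) (κ d) := fun d h1 h2 =>
    hCA _ _ (hd.row_ne d h1 h2) (hdiag d h1 h2)
  have hCκ : ∀ d x, 1 ≤ d → d ≤ r → x ≠ z → C x (κ d) ≠ 0 → d ≤ r' ∧ x = ι d :=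
    fun d x h1 h2 hx hc => hkey d x h1 h2 hx (hC0 _ _ hx hc).1 (hC0 _ _ hx hc).2
  have hcomb : IsComb m z C := by
    constructor
    · intro x j hc
      by_cases hx : x = z
      · subst hx
        rw [hCz] at hc
        obtain ⟨d, h1, h2, rfl⟩ := hw j hc
        have h3 : (κ 1).val ≤ (κ d).val := by
          rcases h1.eq_or_lt with rfl | h1
          · exact le_rfl
          · exact (hd.col_lt 1 d le_rfl h1 h2).le
        have h4 := hd.le_col
        exact ⟨Fin.lt_def.2 (by omega), fun _ => by omega⟩
      · exact hA x j (hC0 x j hx hc).1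
    · intro i j j' hi h1 h2
      by_contra hc
      obtain ⟨h1, hl1⟩ := hC0 _ _ hi h1
      obtain ⟨h2, hl2⟩ := hC0 _ _ hi h2
      obtain ⟨d, h3, h4, h5, rfl⟩ := hmem i j i j' (.inr hc) h1 h2 (.inl rfl) hi hl1
      obtain ⟨d', h3', h4', h5', rfl⟩ :=
        hmem i j' i (κ d) (.inr fun he => hc he.symm) h2 h1 (.inl rfl) hi hl2
      exact hc (by rw [hd.row_inj h3 h4 h3' h4' (h5 ▸ h5')])
    · intro i i' j hi hi' h1 h2
      by_contra hc
      obtain ⟨h1, hl1⟩ := hC0 _ _ hi h1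
      obtain ⟨h2, hl2⟩ := hC0 _ _ hi' h2
      obtain ⟨d, h3, h4, rfl, rfl⟩ := hmem i j i' j (.inl hc) h1 h2 (.inr rfl) hi hl1
      exact hc (hkey d i' h3 (by omega) hi' h2 hl2).2.symm
    · intro i j hj hi hc
      rw [hCz] at hj
      obtain ⟨d, h1, h2, rfl⟩ := hw j hj
      obtain ⟨h3, rfl⟩ := hCκ d i h1 h2 hi hc
      exact hd.row_small d h1 h3
    · intro j k hjk hj hk
      rw [hCz] at hj hk
      obtain ⟨d, h1, h2, rfl⟩ := hw j hj
      obtain ⟨d', h1', h2', rfl⟩ := hw k hk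
      have hdd := (hE.lt_iff h1 h2 h1' h2').1 hjk
      refine ⟨ι d, hd.row_ne d h1 (by omega), ?_, fun i hi hc => ?_⟩
      · rw [hCι d h1 (by omega)]
        exact hA1 d h1 (by omega)
      · obtain ⟨h3, rfl⟩ := hCκ d' i h1' h2' hi hc
        exact hd.row_lt d d' h1 hdd h3
  refine ⟨C, hcomb, ?_⟩
  ext x j
  by_cases hx : x = z
  · subst hx
    by_cases hj : ∃ l, ConsecSupp (C x) l j
    · obtain ⟨l, hl⟩ := hj
      rw [mul_linkMatrix_self_of_consecSupp hl]
      by_contra hc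
      rw [hCz] at hl
      obtain ⟨d, h1, h2, -, h3⟩ := hE.consecSupp_iff.1 hl
      have := hd.col_inj (by omega) (by omega) le_rfl hr (h3.symm.trans (hAz j hc))
      omega
    · push Not at hj
      rw [mul_linkMatrix_self_of_not_consecSupp hj, hCz]
      rw [hCz] at hj
      by_cases hj1 : j = κ 1
      · rw [hj1, hwκ 1 le_rfl hr, hW1]
      · have h1 : A x j = 0 := by
          by_contra hc
          exact hj1 (hAz j hc)
        have h2 : w j = 0 := by
          by_contra hc
          obtain ⟨d, h2, h3, rfl⟩ := hw j hc
          have hd1 : d ≠ 1 := fun h => hj1 (by rw [h])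
          exact hj (κ (d - 1)) (hE.consecSupp_iff.2
            ⟨d - 1, by omega, by omega, rfl, by rw [Nat.sub_add_cancel h2]⟩)
        rw [h1, h2]
  · by_cases hl : link x j
    · obtain ⟨d, h1, h2, rfl, rfl⟩ := hl
      have hcι : C (ι d) (κ d) ≠ 0 := by
        rw [hCι d h1 (by omega)]
        exact hA1 d h1 (by omega)
      rw [mul_linkMatrix_of_row (p := κ d) (fun l hl => hcomb.row _ _ _ hx hl hcι), hCz,
        linkMatrix_of_consecSupp (hE.consecSupp_iff.2 ⟨d, h1, h2, rfl, rfl⟩),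
        hwκ d h1 h2.le, hwκ (d + 1) (by omega) (by omega), hWs d h1, hCι d h1 (by omega)]
      have := hA1 d h1 (by omega)
      have := hW d h1 h2.le
      field_simp
    · rw [← hCA x j hx hl]
      by_cases hc : C x j = 0
      · rw [hc]
        by_contra hne
        obtain ⟨p, hp, rfl | hcs⟩ := (hcomb.mul_linkMatrix_ne_zero_iff hx).1 (Ne.symm hne)
        · exact hp hc
        · rw [hCz] at hcs
          obtain ⟨d, h1, h2, rfl, rfl⟩ := hE.consecSupp_iff.1 hcs
          exact hl ⟨d, h1, h2, (hCκ d x h1 h2.le hx hp).2, rfl⟩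
      · rw [mul_linkMatrix_of_row (p := j) (fun l hl => hcomb.row _ _ _ hx hl hc),
          linkMatrix_self, mul_one]

end PathToComb

/-- For `0 < m < n`, every superclass of `U_(m)` contains exactly one path
superclass representative. -/
theorem stmt7 {n m : ℕ} (hm : 0 < m) (hmn : m < n) {F : Type*} [Field F] [Fintype F]
    (u : Mat n F) (hu : u ∈ patGroup (Pm n m)) :
    ∃! v : Mat n F, v ∈ patGroup (Pm n m) ∧ IsPathClassRep m (v - 1) ∧
      (u - 1) ∈ classOrbit (Pm n m) v := by
  let z : Fin n := ⟨0, by omega⟩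
  have hz : ∀ i, z ≤ i := fun i => Fin.le_def.2 (Nat.zero_le _)
  have hz0 : z.val = 0 := rfl
  have hlink : ∀ {C : Mat n F}, IsComb m z C → SameOrbit m C (C * linkMatrix (C z)) := fun hC =>
    ⟨1, one_mem_patGroup, _, linkMatrix_mem_patGroup hz0 (fun j hj => hC.supp z j hj),
      by rw [Matrix.one_mul]⟩
  have hA := mem_patGroup_iff_sub_one.1 hu
  obtain ⟨C, hAC, hC⟩ := exists_isComb hz hz0 hA
  have hP := hAC.trans (hlink hC)
  refine ⟨C * linkMatrix (C z) + 1, ⟨?_, ?_, ?_⟩, ?_⟩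
  · rw [mem_patGroup_iff_sub_one, add_sub_cancel_right]
    exact hP.pmSupported hA
  · rw [add_sub_cancel_right]
    exact hC.isPathClassRep hm hz0
  · obtain ⟨a, ha, b, hb, h⟩ := hP.symm
    exact ⟨a, ha, b, hb, by rw [add_sub_cancel_right, h]⟩
  · rintro v ⟨hv, hvrep, a, ha, b, hb, h⟩
    obtain ⟨D, hD, hvD⟩ :=
      hvrep.exists_eq_mul_linkMatrix hm hmn hz0 (mem_patGroup_iff_sub_one.1 hv)
    have hvu : SameOrbit m (v - 1) (u - 1) := ⟨a, ha, b, hb, h⟩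
    have hDv : SameOrbit m D (v - 1) := hvD ▸ hlink hD
    have hDC : SameOrbit m C D := ((hDv.trans hvu).trans hAC).symm
    have := hC.eq_of_sameOrbit hz hz0 hD hDC
    rw [← sub_eq_iff_eq_add, hvD, this]
end
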